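/- Let f₁,…,f_m ∈ ℝ[x₁,…,x_d] be finitely many polynomials that generate ℝ[x₁,…,x_d] as an ℝ-algebra. Suppose L is a linear functional on ℝ[x₁,…,x_d] satisfying L(p²) ≥ 0 and L(f_j·p²) ≥ 0 for all p ∈ ℝ[x₁,…,x_d] and all j = 1,…,m, and such that for each j = 1,…,m the series Σ_{n=1}^∞ L(f_jⁿ)^{-1/(2n)} diverges to +∞. Then L is a moment functional: there exists a measure μ on ℝ^d, supported on the semi-algebraic set K(f) = {x ∈ ℝ^d : f₁(x) ≥ 0, …, f_m(x) ≥ 0}, such that every polynomial is μ-integrable and L(p) = ∫ p dμ for all p ∈ ℝ[x₁,…,x_d]; moreover this representing measure is unique among all measures on ℝ^d representing L. -/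

import Mathlib

open MeasureTheory MvPolynomial

section OrthogonalPolynomials

/-- Consecutive monic orthogonal polynomials of a functional, starting from `(0, 1)`. -/
noncomputable def monicOrthogonalPair (M : Polynomial ℝ →ₗ[ℝ] ℝ) :
    ℕ → Polynomial ℝ × Polynomial ℝ
  | 0 => (0, 1)
  | n + 1 =>
    let r := monicOrthogonalPair M n
    (r.2, Polynomial.X * r.2 - (M (Polynomial.X * (r.2 * r.2)) / M (r.2 * r.2)) • r.2
      - (M (r.2 * r.2) / M (r.1 * r.1)) • r.1)

theorem exists_orthogonal_polynomials (M : Polynomial ℝ →ₗ[ℝ] ℝ)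
    (hM : ∀ g : Polynomial ℝ, g ≠ 0 → 0 < M (g * g)) :
    ∃ (p : ℕ → Polynomial ℝ) (a c : ℕ → ℝ), p 0 = 0 ∧ p 1 = 1 ∧
      (∀ n, Polynomial.X * p (n + 1) = p (n + 2) + a n • p (n + 1) + c n • p n) ∧
      (∀ n k, k < n → M (p n * p k) = 0) ∧
      (∀ n, 0 < M (p (n + 1) * p (n + 1))) ∧
      (∀ n, c (n + 1) * M (p (n + 1) * p (n + 1)) = M (p (n + 2) * p (n + 2))) := by
  set p : ℕ → Polynomial ℝ := fun n => (monicOrthogonalPair M n).1 with hp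
  have hp2 : ∀ n, (monicOrthogonalPair M n).2 = p (n + 1) := fun n => rfl
  set a : ℕ → ℝ := fun n =>
    M (Polynomial.X * (p (n + 1) * p (n + 1))) / M (p (n + 1) * p (n + 1)) with ha
  set c : ℕ → ℝ := fun n => M (p (n + 1) * p (n + 1)) / M (p n * p n) with hc
  have h0 : p 0 = 0 := rfl
  have h1 : p 1 = 1 := rfl
  have hdef : ∀ n, p (n + 2) = Polynomial.X * p (n + 1) - a n • p (n + 1) - c n • p n :=
    fun n => rfl
  have hrec : ∀ n, Polynomial.X * p (n + 1) = p (n + 2) + a n • p (n + 1) + c n • p n := by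
    intro n; rw [hdef]; abel
  have hmonic : ∀ n, ((p (n + 1)).Monic ∧ (p (n + 1)).natDegree = n) ∧
      ((p (n + 2)).Monic ∧ (p (n + 2)).natDegree = n + 1) := by
    have key : ∀ (r s : Polynomial ℝ) (α β : ℝ) (n : ℕ), r.Monic → r.natDegree = n →
        s.degree ≤ n → (Polynomial.X * r - α • r - β • s).Monic ∧
          (Polynomial.X * r - α • r - β • s).natDegree = n + 1 := by
      intro r s α β n hr hn hs
      have hX : (Polynomial.X * r).Monic := Polynomial.monic_X.mul hr
      have hXd : (Polynomial.X * r).degree = ((n + 1 : ℕ) : WithBot ℕ) := by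
        rw [Polynomial.degree_mul, Polynomial.degree_X, Polynomial.degree_eq_natDegree hr.ne_zero,
          hn]
        push_cast; ring
      have hrd : r.degree ≤ n := by rw [Polynomial.degree_eq_natDegree hr.ne_zero, hn]
      have hlow : (α • r + β • s).degree < (Polynomial.X * r).degree := by
        rw [hXd]
        refine lt_of_le_of_lt (Polynomial.degree_add_le _ _) ?_
        refine lt_of_le_of_lt (max_le ((Polynomial.degree_smul_le _ _).trans hrd)
          ((Polynomial.degree_smul_le _ _).trans hs)) ?_
        exact_mod_cast Nat.lt_succ_self n
      rw [sub_sub]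
      refine ⟨hX.sub_of_left hlow, ?_⟩
      apply Polynomial.natDegree_eq_of_degree_eq_some
      rw [Polynomial.degree_sub_eq_left_of_degree_lt hlow, hXd]
    intro n
    induction n with
    | zero =>
      refine ⟨by simp [h1], ?_⟩
      rw [hdef 0]
      exact key _ _ _ _ 0 (by simp [h1]) (by simp [h1]) (by simp [h0])
    | succ n ih =>
      refine ⟨ih.2, ?_⟩
      rw [hdef (n + 1)]
      refine key _ _ _ _ (n + 1) ih.2.1 ih.2.2 ?_
      rw [Polynomial.degree_eq_natDegree ih.1.1.ne_zero, ih.1.2]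
      exact_mod_cast Nat.le_succ n
  have hpos : ∀ n, 0 < M (p (n + 1) * p (n + 1)) := fun n => hM _ (hmonic n).1.1.ne_zero
  have horth : ∀ n, (∀ k < n, M (p n * p k) = 0) ∧ (∀ k < n + 1, M (p (n + 1) * p k) = 0) := by
    intro n
    induction n with
    | zero =>
      refine ⟨by simp, ?_⟩
      intro k hk
      obtain rfl : k = 0 := by omega
      simp [h0]
    | succ n ih =>
      refine ⟨ih.2, ?_⟩
      intro k hk
      have e : M (p (n + 1 + 1) * p k) = M (p (n + 1) * (Polynomial.X * p k))
          - a n * M (p (n + 1) * p k) - c n * M (p n * p k) := by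
        rw [hdef n]
        have : (Polynomial.X * p (n + 1) - a n • p (n + 1) - c n • p n) * p k
          = p (n + 1) * (Polynomial.X * p k) - a n • (p (n + 1) * p k) - c n • (p n * p k) := by
          simp only [sub_mul, smul_mul_assoc]; ring
        rw [this]; simp
      rcases Nat.lt_or_ge n k with h | h
      · obtain rfl : k = n + 1 := by omega
        rw [e, mul_comm (p n), ih.2 n (by omega)]
        have : p (n + 1) * (Polynomial.X * p (n + 1)) = Polynomial.X * (p (n + 1) * p (n + 1)) := by
          ring
        rw [this]
        have := (hpos n).ne'
        simp only [ha]; field_simp; ring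
      · rcases k with _ | k
        · simp [h0]
        · rw [e, hrec k, ih.2 (k + 1) (by omega)]
          simp only [mul_add, mul_smul_comm, map_add, map_smul, smul_eq_mul]
          rw [ih.2 (k + 1) (by omega), ih.2 k (by omega)]
          rcases Nat.lt_or_ge (k + 1) n with h' | h'
          · rw [ih.2 (k + 2) (by omega), ih.1 (k + 1) h']; ring
          · obtain rfl : n = k + 1 := by omega
            have := (hpos k).ne'
            simp only [hc]; field_simp; ring
  refine ⟨p, a, c, h0, h1, hrec, fun n => (horth n).1, hpos, fun n => ?_⟩
  have := (hpos n).ne'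
  simp only [hc]; field_simp

end OrthogonalPolynomials

theorem sq_map_mul_le {B : Type*} [CommRing B] [Algebra ℝ B] (M : B →ₗ[ℝ] ℝ)
    (hM : ∀ u, 0 ≤ M (u * u)) (u v : B) : M (u * v) ^ 2 ≤ M (u * u) * M (v * v) := by
  have h : ∀ t : ℝ, 0 ≤ M (u * u) * (t * t) + (2 * M (u * v)) * t + M (v * v) := by
    intro t
    have e : (t • u + v) * (t • u + v) = (t * t) • (u * u) + (2 * t) • (u * v) + v * v := by
      simp only [Algebra.smul_def, map_mul, map_ofNat]; ring
    have := hM (t • u + v)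
    rw [e] at this
    simp only [map_add, map_smul, smul_eq_mul] at this
    linarith
  have := discrim_le_zero h
  unfold discrim at this
  nlinarith

/-- A weak form of Carleman's inequality. -/
theorem summable_geomMean {x : ℕ → ℝ} (hx : ∀ n, 0 ≤ x n) (hs : Summable x) :
    Summable fun n : ℕ => (∏ k ∈ Finset.range (n + 1), x k) ^ (1 / ((n : ℝ) + 1)) := by
  set y : ℕ → ℝ := fun k => ((k : ℝ) + 1) * x k with hy
  have hy0 : ∀ k, 0 ≤ y k := fun k => mul_nonneg (by positivity) (hx k)
  set S : ℕ → ℝ := fun N => ∑ k ∈ Finset.range N, y k with hS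
  have hS0 : ∀ N, 0 ≤ S N := fun N => Finset.sum_nonneg fun k _ => hy0 k
  have hprod : ∀ n, (∏ k ∈ Finset.range (n + 1), x k) ^ (1 / ((n : ℝ) + 1)) ≤
      Real.exp 1 * (S (n + 1) / ((n : ℝ) + 1) ^ 2) := by
    intro n
    have hn : (0 : ℝ) < (n : ℝ) + 1 := by positivity
    have hfac : ∏ k ∈ Finset.range (n + 1), y k =
        ((n + 1).factorial : ℝ) * ∏ k ∈ Finset.range (n + 1), x k := by
      rw [Finset.prod_mul_distrib, ← Finset.prod_range_add_one_eq_factorial]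
      push_cast; rfl
    have hgm : (∏ k ∈ Finset.range (n + 1), y k) ^ (1 / ((n : ℝ) + 1)) ≤
        S (n + 1) / ((n : ℝ) + 1) := by
      have := Real.geom_mean_le_arith_mean_weighted (Finset.range (n + 1))
        (fun _ => 1 / ((n : ℝ) + 1)) y (fun _ _ => by positivity)
        (by simp; field_simp) (fun k _ => hy0 k)
      rw [Real.finsetProd_rpow _ _ (fun k _ => hy0 k), ← Finset.mul_sum] at this
      simpa [hS, div_eq_inv_mul] using this
    have hfl : ((n : ℝ) + 1) / Real.exp 1 ≤ ((n + 1).factorial : ℝ) ^ (1 / ((n : ℝ) + 1)) := by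
      have h1 := Real.pow_div_factorial_le_exp ((n : ℝ) + 1) hn.le (n + 1)
      have hf : (0 : ℝ) < (n + 1).factorial := by positivity
      rw [div_le_iff₀ hf] at h1
      have h2 : (((n : ℝ) + 1) / Real.exp 1) ^ (n + 1) ≤ (n + 1).factorial := by
        rw [div_pow, div_le_iff₀ (by positivity), ← Real.exp_nat_mul]
        push_cast
        rw [mul_one]; linarith
      have h3 := Real.rpow_le_rpow (by positivity) h2 (z := 1 / ((n : ℝ) + 1)) (by positivity)
      refine le_trans (le_of_eq ?_) h3
      rw [← Real.rpow_natCast, ← Real.rpow_mul (by positivity)]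
      push_cast
      rw [mul_one_div_cancel hn.ne', Real.rpow_one]
    have hP : 0 ≤ ∏ k ∈ Finset.range (n + 1), x k := Finset.prod_nonneg fun k _ => hx k
    rw [hfac, Real.mul_rpow (by positivity) hP] at hgm
    have hG := Real.rpow_nonneg hP (1 / ((n : ℝ) + 1))
    set G := (∏ k ∈ Finset.range (n + 1), x k) ^ (1 / ((n : ℝ) + 1))
    have h4 : ((n : ℝ) + 1) / Real.exp 1 * G ≤ S (n + 1) / ((n : ℝ) + 1) :=
      (mul_le_mul_of_nonneg_right hfl hG).trans hgm
    have he := Real.exp_pos 1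
    rw [div_mul_eq_mul_div, div_le_div_iff₀ he hn] at h4
    rw [← mul_div_assoc, le_div_iff₀ (by positivity)]
    nlinarith
  have hsum : ∀ N : ℕ, ∑ n ∈ Finset.range N, S (n + 1) / ((n : ℝ) + 1) ^ 2 + S N / N ≤
      2 * ∑ k ∈ Finset.range N, x k := by
    intro N
    induction N with
    | zero => simp
    | succ N ih =>
      rw [Finset.sum_range_succ, Finset.sum_range_succ]
      have hSs : S (N + 1) = S N + ((N : ℝ) + 1) * x N := Finset.sum_range_succ _ _
      have hN1 : (0 : ℝ) < (N : ℝ) + 1 := by positivity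
      have h1 : S (N + 1) / ((N : ℝ) + 1) ^ 2 + S (N + 1) / ((N + 1 : ℕ) : ℝ) ≤
          S N / N + 2 * x N := by
        have hx1 : ((N : ℝ) + 1) * x N / ((N : ℝ) + 1) ^ 2 + ((N : ℝ) + 1) * x N / ((N : ℝ) + 1)
            ≤ 2 * x N := by
          have e1 : ((N : ℝ) + 1) * x N / ((N : ℝ) + 1) ^ 2 = x N / ((N : ℝ) + 1) := by
            field_simp
          have e2 : ((N : ℝ) + 1) * x N / ((N : ℝ) + 1) = x N := by field_simp
          have e3 : x N / ((N : ℝ) + 1) ≤ x N :=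
            div_le_self (hx N) (by linarith [(Nat.cast_nonneg N : (0 : ℝ) ≤ N)])
          linarith
        have hx2 : S N / ((N : ℝ) + 1) ^ 2 + S N / ((N : ℝ) + 1) ≤ S N / N := by
          rcases Nat.eq_zero_or_pos N with rfl | hN
          · simp [hS]
          · have hN' : (0 : ℝ) < N := by exact_mod_cast hN
            have e : S N / N - (S N / ((N : ℝ) + 1) ^ 2 + S N / ((N : ℝ) + 1)) =
                S N / (N * ((N : ℝ) + 1) ^ 2) := by field_simp; ring
            have := div_nonneg (hS0 N) (by positivity : (0 : ℝ) ≤ N * ((N : ℝ) + 1) ^ 2)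
            linarith
        push_cast
        rw [hSs, add_div, add_div]
        linarith
      linarith
  refine Summable.of_nonneg_of_le (fun n => ?_) hprod ?_
  · exact Real.rpow_nonneg (Finset.prod_nonneg fun k _ => hx k) _
  · refine Summable.mul_left _ ?_
    refine summable_of_sum_range_le (c := 2 * ∑' k, x k) (fun n => ?_) fun N => ?_
    · exact div_nonneg (hS0 _) (by positivity)
    · have h1 := hsum N
      have h2 : 0 ≤ S N / N := div_nonneg (hS0 N) (by positivity)
      have h3 := hs.sum_le_tsum (Finset.range N) (fun k _ => hx k)
      linarith

theorem summable_christoffel_imp_ne_top (M : Polynomial ℝ →ₗ[ℝ] ℝ)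
    (hM : ∀ g : Polynomial ℝ, 0 ≤ M (g * g)) (z : ℂ) (hz : z.im ≠ 0)
    (p : ℕ → Polynomial ℝ) (a c : ℕ → ℝ) (h0 : p 0 = 0) (h1 : p 1 = 1)
    (hrec : ∀ n, Polynomial.X * p (n + 1) = p (n + 2) + a n • p (n + 1) + c n • p n)
    (horth : ∀ n k, k < n → M (p n * p k) = 0)
    (hpos : ∀ n, 0 < M (p (n + 1) * p (n + 1)))
    (hc : ∀ n, c (n + 1) * M (p (n + 1) * p (n + 1)) = M (p (n + 2) * p (n + 2)))
    (hs : Summable fun n =>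
      ‖Polynomial.aeval z (p (n + 1))‖ ^ 2 / M (p (n + 1) * p (n + 1))) :
    ∑' n : ℕ, (ENNReal.ofReal (M (Polynomial.X ^ (2 * (n + 1)))))
      ^ (-(1 / (2 * ((n : ℝ) + 1)))) ≠ ⊤ := by
  set h : ℕ → ℝ := fun n => M (p (n + 1) * p (n + 1)) with hh
  set u : ℕ → ℂ := fun n => Polynomial.aeval z (p n) with hu
  have hu0 : u 0 = 0 := by simp [hu, h0]
  have hu1 : u 1 = 1 := by simp [hu, h1]
  have hurec : ∀ n, z * u (n + 1) = u (n + 2) + a n * u (n + 1) + c n * u n := by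
    intro n
    have := congrArg (Polynomial.aeval z) (hrec n)
    simpa [hu] using this
  set v : ℕ → ℝ := fun n => ‖u (n + 1)‖ ^ 2 / h n with hv
  have hv0 : ∀ n, 0 ≤ v n := fun n => div_nonneg (sq_nonneg _) (hpos n).le
  -- Christoffel–Darboux
  have hCD : ∀ n, z.im * ∑ k ∈ Finset.range (n + 1), v k =
      (u (n + 2) * (starRingEnd ℂ) (u (n + 1))).im / h n := by
    intro n
    have key : ∀ n, (u (n + 2) * (starRingEnd ℂ) (u (n + 1))).im = z.im * ‖u (n + 1)‖ ^ 2
        + c n * (u (n + 1) * (starRingEnd ℂ) (u n)).im := by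
      intro n
      have e : u (n + 2) = z * u (n + 1) - a n * u (n + 1) - c n * u n := by
        rw [hurec n]; ring
      rw [e, ← Complex.normSq_eq_norm_sq, Complex.normSq_apply]
      simp
      ring
    induction n with
    | zero =>
      simp [key 0, hv, hu0]; ring
    | succ n ih =>
      have hch : c (n + 1) * h n = h (n + 1) := hc n
      have h2 : h n ≠ 0 := (hpos n).ne'
      have h3 : h (n + 1) ≠ 0 := (hpos (n + 1)).ne'
      have h4 : c (n + 1) ≠ 0 := fun h => h3 (by rw [← hch, h, zero_mul])
      have h5 : v (n + 1) = ‖u (n + 1 + 1)‖ ^ 2 / h (n + 1) := rfl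
      rw [Finset.sum_range_succ, mul_add, ih, key (n + 1), h5, ← hch]
      field_simp
      ring
  have hCDle : ∀ n, Real.sqrt (h n / h (n + 1)) ≤ h 0 / |z.im| * ((v n + v (n + 1)) / 2) := by
    intro n
    have hy : 0 < |z.im| := abs_pos.mpr hz
    have hhn := hpos n
    have hhn1 := hpos (n + 1)
    change 0 < h n at hhn
    change 0 < h (n + 1) at hhn1
    have hh0 : 0 < h 0 := hpos 0
    have hv00 : v 0 = 1 / h 0 := by simp [hv, hu1]
    have hge : 1 / h 0 ≤ ∑ k ∈ Finset.range (n + 1), v k := by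
      rw [← hv00]
      exact Finset.single_le_sum (f := v) (fun k _ => hv0 k) (by simp)
    have hb : |z.im| * (1 / h 0) ≤ ‖u (n + 2)‖ * ‖u (n + 1)‖ / h n := by
      calc |z.im| * (1 / h 0) ≤ |z.im| * ∑ k ∈ Finset.range (n + 1), v k := by gcongr
        _ = |z.im * ∑ k ∈ Finset.range (n + 1), v k| := by
          rw [abs_mul, abs_of_nonneg (Finset.sum_nonneg fun k _ => hv0 k)]
        _ ≤ ‖u (n + 2)‖ * ‖u (n + 1)‖ / h n := by
          rw [hCD n, abs_div, abs_of_pos hhn]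
          gcongr
          refine (Complex.abs_im_le_norm _).trans ?_
          simp
    set s := Real.sqrt (h n) with hsdef
    set t := Real.sqrt (h (n + 1)) with htdef
    have hs0 : 0 < s := Real.sqrt_pos.mpr hhn
    have ht0 : 0 < t := Real.sqrt_pos.mpr hhn1
    have hss : s ^ 2 = h n := Real.sq_sqrt hhn.le
    have htt : t ^ 2 = h (n + 1) := Real.sq_sqrt hhn1.le
    rw [Real.sqrt_div hhn.le]
    have hvn : v n = (‖u (n + 1)‖ / s) ^ 2 := by rw [div_pow, hss]
    have hvn1 : v (n + 1) = (‖u (n + 2)‖ / t) ^ 2 := by rw [div_pow, htt]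
    have h5 : ‖u (n + 2)‖ * ‖u (n + 1)‖ / h n =
        (t / s) * ((‖u (n + 2)‖ / t) * (‖u (n + 1)‖ / s)) := by
      rw [← hss]; field_simp
    have h6 : (‖u (n + 2)‖ / t) * (‖u (n + 1)‖ / s) ≤ (v n + v (n + 1)) / 2 := by
      rw [hvn, hvn1]
      nlinarith [sq_nonneg (‖u (n + 2)‖ / t - ‖u (n + 1)‖ / s)]
    have h7 : |z.im| * (1 / h 0) ≤ (t / s) * ((v n + v (n + 1)) / 2) :=
      hb.trans (by rw [h5]; gcongr)
    have h8 : s / t * (h 0 / |z.im|) * (|z.im| * (1 / h 0)) = s / t := by field_simp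
    have h9 : s / t * (h 0 / |z.im|) * ((t / s) * ((v n + v (n + 1)) / 2)) =
        h 0 / |z.im| * ((v n + v (n + 1)) / 2) := by field_simp
    calc s / t = s / t * (h 0 / |z.im|) * (|z.im| * (1 / h 0)) := h8.symm
      _ ≤ s / t * (h 0 / |z.im|) * ((t / s) * ((v n + v (n + 1)) / 2)) := by gcongr
      _ = _ := h9
  set x : ℕ → ℝ := fun n => Real.sqrt (h n / h (n + 1)) with hx
  have hxs : Summable x := by
    refine Summable.of_nonneg_of_le (fun n => Real.sqrt_nonneg _) hCDle ?_
    exact (((hs.add ((summable_nat_add_iff 1).mpr hs)).div_const 2).mul_left _)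
  have hgm := summable_geomMean (fun n => Real.sqrt_nonneg _) hxs
  have hprod : ∀ n, ∏ k ∈ Finset.range (n + 1), x k = Real.sqrt (h 0 / h (n + 1)) := by
    intro n
    induction n with
    | zero => simp [hx]
    | succ n ih =>
      rw [Finset.prod_range_succ, ih, hx, ← Real.sqrt_mul]
      · congr 1
        have := hpos (n + 1)
        change 0 < h (n + 1) at this
        field_simp
      · exact div_nonneg (hpos _).le (hpos _).le
  have hpow : ∀ k n, (k < n → M (Polynomial.X ^ k * p (n + 1)) = 0) ∧
      (k = n → M (Polynomial.X ^ k * p (n + 1)) = h n) := by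
    intro k
    induction k with
    | zero =>
      intro n
      refine ⟨fun hn => ?_, ?_⟩
      · have := horth (n + 1) 1 (by omega)
        rw [h1, mul_one] at this
        simpa using this
      · rintro rfl
        simp [hh, h1]
    | succ k ih =>
      intro n
      rcases n with _ | m
      · exact ⟨fun h => by omega, fun h => by omega⟩
      have e : M (Polynomial.X ^ (k + 1) * p (m + 1 + 1)) = M (Polynomial.X ^ k * p (m + 2 + 1))
          + a (m + 1) * M (Polynomial.X ^ k * p (m + 1 + 1))
          + c (m + 1) * M (Polynomial.X ^ k * p (m + 1)) := by
        rw [pow_succ, mul_assoc, hrec (m + 1)]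
        simp [mul_add]
      refine ⟨fun hk => ?_, fun hk => ?_⟩
      · rw [e, (ih (m + 2)).1 (by omega), (ih (m + 1)).1 (by omega), (ih m).1 (by omega)]
        simp
      · rw [e, (ih (m + 2)).1 (by omega), (ih (m + 1)).1 (by omega), (ih m).2 (by omega)]
        simpa using hc m
  have hmom : ∀ n, h n ≤ M (Polynomial.X ^ (2 * n)) := by
    intro n
    have h2 := sq_map_mul_le M hM (Polynomial.X ^ n) (p (n + 1))
    rw [(hpow n n).2 rfl, ← pow_add, ← two_mul] at h2
    change h n ^ 2 ≤ _ * h n at h2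
    have := hpos n
    change 0 < h n at this
    nlinarith
  set K : ℝ := max 1 (1 / h 0) with hK
  have hterm : ∀ n : ℕ, (ENNReal.ofReal (M (Polynomial.X ^ (2 * (n + 1)))))
      ^ (-(1 / (2 * ((n : ℝ) + 1)))) ≤
      ENNReal.ofReal (K * (∏ k ∈ Finset.range (n + 1), x k) ^ (1 / ((n : ℝ) + 1))) := by
    intro n
    have hs0 : 0 < M (Polynomial.X ^ (2 * (n + 1))) := lt_of_lt_of_le (hpos (n + 1)) (hmom (n + 1))
    have hh0 : 0 < h 0 := hpos 0
    have hhn : 0 < h (n + 1) := hpos (n + 1)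
    rw [ENNReal.ofReal_rpow_of_pos hs0]
    apply ENNReal.ofReal_le_ofReal
    rw [hprod, Real.sqrt_eq_rpow, ← Real.rpow_mul (by positivity)]
    have e1 : (1 / 2 : ℝ) * (1 / ((n : ℝ) + 1)) = 1 / (2 * ((n : ℝ) + 1)) := by
      field_simp
    rw [e1]
    set r : ℝ := 1 / (2 * ((n : ℝ) + 1)) with hr
    have hr0 : 0 ≤ r := by positivity
    have hr1 : r ≤ 1 := by
      rw [hr, div_le_one (by positivity)]
      linarith [(Nat.cast_nonneg n : (0 : ℝ) ≤ n)]
    calc M (Polynomial.X ^ (2 * (n + 1))) ^ (-r) ≤ h (n + 1) ^ (-r) :=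
          Real.rpow_le_rpow_of_nonpos hhn (hmom (n + 1)) (by linarith)
      _ = (1 / h 0) ^ r * (h 0 / h (n + 1)) ^ r := by
        rw [← Real.mul_rpow (by positivity) (by positivity), Real.rpow_neg hhn.le,
          ← Real.inv_rpow hhn.le]
        congr 1
        field_simp
      _ ≤ K * (h 0 / h (n + 1)) ^ r := by
        gcongr
        calc (1 / h 0) ^ r ≤ K ^ r := by gcongr; exact le_max_right _ _
          _ ≤ K ^ (1 : ℝ) := Real.rpow_le_rpow_of_exponent_le (le_max_left _ _) hr1
          _ = K := Real.rpow_one K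
  refine ne_top_of_le_ne_top ?_ (ENNReal.tsum_le_tsum hterm)
  exact (hgm.mul_left K).tsum_ofReal_ne_top

theorem exists_small_of_carleman (M : Polynomial ℝ →ₗ[ℝ] ℝ)
    (hM : ∀ g : Polynomial ℝ, 0 ≤ M (g * g)) (z : ℂ) (hz : z.im ≠ 0)
    (hC : ∑' n : ℕ, (ENNReal.ofReal (M (Polynomial.X ^ (2 * (n + 1)))))
      ^ (-(1 / (2 * ((n : ℝ) + 1)))) = ⊤) {ε : ℝ} (hε : 0 < ε) :
    ∃ a b : Polynomial ℝ, Polynomial.aeval z a + Complex.I * Polynomial.aeval z b = 1 ∧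
      M (a * a + b * b) < ε := by
  by_cases hnd : ∀ g : Polynomial ℝ, g ≠ 0 → 0 < M (g * g)
  · obtain ⟨p, a, c, h0, h1, hrec, horth, hpos, hc⟩ := exists_orthogonal_polynomials M hnd
    have hns := fun hs => summable_christoffel_imp_ne_top M hM z hz p a c h0 h1 hrec horth hpos hc
      hs hC
    set h : ℕ → ℝ := fun n => M (p (n + 1) * p (n + 1)) with hh
    set u : ℕ → ℂ := fun n => Polynomial.aeval z (p (n + 1)) with hu
    have hv0 : ∀ n, 0 ≤ ‖u n‖ ^ 2 / h n := fun n => div_nonneg (sq_nonneg _) (hpos n).le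
    obtain ⟨N, hN⟩ : ∃ N, 1 / ε < ∑ k ∈ Finset.range N, ‖u k‖ ^ 2 / h k := by
      by_contra hcon
      push Not at hcon
      exact hns (summable_of_sum_range_le hv0 hcon)
    set S : ℝ := ∑ k ∈ Finset.range N, ‖u k‖ ^ 2 / h k with hS
    have hS0 : 0 < S := lt_trans (by positivity) hN
    have hquad : ∀ w : ℕ → ℝ, M ((∑ k ∈ Finset.range N, w k • p (k + 1)) *
        (∑ k ∈ Finset.range N, w k • p (k + 1))) = ∑ k ∈ Finset.range N, w k ^ 2 * h k := by
      intro w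
      rw [Finset.sum_mul_sum, map_sum]
      refine Finset.sum_congr rfl fun i hi => ?_
      rw [map_sum, Finset.sum_eq_single i]
      · simp [hh]; ring
      · intro j _ hji
        rw [smul_mul_smul_comm, map_smul]
        rcases lt_or_gt_of_ne hji with hlt | hlt
        · rw [horth _ _ (by omega : j + 1 < i + 1), smul_zero]
        · rw [mul_comm (p _), horth _ _ (by omega : i + 1 < j + 1), smul_zero]
      · exact fun hn => absurd hi hn
    refine ⟨∑ k ∈ Finset.range N, ((u k).re / h k / S) • p (k + 1),
      ∑ k ∈ Finset.range N, (-(u k).im / h k / S) • p (k + 1), ?_, ?_⟩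
    · simp only [map_sum, map_smul]
      rw [Finset.mul_sum, ← Finset.sum_add_distrib]
      have : ∀ k ∈ Finset.range N, ((u k).re / h k / S) • (Polynomial.aeval z) (p (k + 1)) +
          Complex.I * ((-(u k).im / h k / S) • (Polynomial.aeval z) (p (k + 1))) =
          (((‖u k‖ ^ 2 / h k) / S : ℝ) : ℂ) := by
        intro k _
        change ((u k).re / h k / S) • u k + Complex.I * ((-(u k).im / h k / S) • u k) = _
        rw [← Complex.normSq_eq_norm_sq, Complex.normSq_apply]
        apply Complex.ext
        · simp; ring
        · simp; ring
      rw [Finset.sum_congr rfl this, ← Complex.ofReal_sum, ← Finset.sum_div, ← hS,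
        div_self hS0.ne', Complex.ofReal_one]
    · rw [map_add, hquad, hquad, ← Finset.sum_add_distrib]
      have : ∀ k ∈ Finset.range N, ((u k).re / h k / S) ^ 2 * h k +
          (-(u k).im / h k / S) ^ 2 * h k = (‖u k‖ ^ 2 / h k) / S ^ 2 := by
        intro k _
        have := (hpos k).ne'
        change h k ≠ 0 at this
        rw [← Complex.normSq_eq_norm_sq, Complex.normSq_apply]
        field_simp
      rw [Finset.sum_congr rfl this, ← Finset.sum_div, ← hS]
      have e : S / S ^ 2 = 1 / S := by field_simp
      rw [e]
      exact (one_div_lt hε hS0).mp hN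
  · push Not at hnd
    have hnd' : ∃ n : ℕ, ∃ g : Polynomial ℝ, g.natDegree = n ∧ g ≠ 0 ∧ M (g * g) = 0 := by
      obtain ⟨g, hg, hg0⟩ := hnd
      exact ⟨_, g, rfl, hg, le_antisymm hg0 (hM g)⟩
    classical
    obtain ⟨g, hgd, hg, hg0⟩ := Nat.find_spec hnd'
    have hmin := fun m => Nat.find_min hnd' (m := m)
    rw [← hgd] at hmin
    have hgz : Polynomial.aeval z g ≠ 0 := by
      intro hroot
      obtain ⟨q, hq⟩ := g.quadratic_dvd_of_aeval_eq_zero_im_ne_zero hroot hz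
      have hq0 : q ≠ 0 := by rintro rfl; exact hg (by simpa using hq)
      have hdeg : (Polynomial.X ^ 2 - Polynomial.C (2 * z.re) * Polynomial.X +
          Polynomial.C (‖z‖ ^ 2) : Polynomial ℝ).natDegree = 2 := by
        compute_degree!
      have hd : q.natDegree < g.natDegree := by
        have hf : (Polynomial.X ^ 2 - Polynomial.C (2 * z.re) * Polynomial.X +
          Polynomial.C (‖z‖ ^ 2) : Polynomial ℝ) ≠ 0 := by
          intro h; rw [h] at hdeg; simp at hdeg
        rw [hq, Polynomial.natDegree_mul hf hq0, hdeg]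
        omega
      refine hmin _ hd ⟨q, rfl, hq0, ?_⟩
      have hnorm : ‖z‖ ^ 2 = z.re ^ 2 + z.im ^ 2 := by
        rw [← Complex.normSq_eq_norm_sq, Complex.normSq_apply]; ring
      have e : g * g = (((Polynomial.X - Polynomial.C z.re) ^ 2 * q) *
          ((Polynomial.X - Polynomial.C z.re) ^ 2 * q)) +
          (2 * z.im ^ 2) • (((Polynomial.X - Polynomial.C z.re) * q) *
          ((Polynomial.X - Polynomial.C z.re) * q)) + (z.im ^ 4) • (q * q) := by
        rw [hq, hnorm]
        simp only [Polynomial.smul_eq_C_mul, map_add, map_mul, map_pow]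
        have : (Polynomial.C (2 : ℝ)) = 2 := map_ofNat Polynomial.C 2
        rw [this]
        ring
      rw [e, map_add, map_add, map_smul, map_smul, smul_eq_mul, smul_eq_mul] at hg0
      have i1 := hM ((Polynomial.X - Polynomial.C z.re) ^ 2 * q)
      have i2 := mul_nonneg (by positivity : 0 ≤ 2 * z.im ^ 2)
        (hM ((Polynomial.X - Polynomial.C z.re) * q))
      have i3 := hM q
      have i4 : 0 < z.im ^ 4 := by positivity
      have i5 : z.im ^ 4 * M (q * q) ≤ 0 := by linarith
      nlinarith
    set w := (Polynomial.aeval z g)⁻¹ with hw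
    refine ⟨w.re • g, w.im • g, ?_, ?_⟩
    · simp only [map_smul]
      have : w.re • Polynomial.aeval z g + Complex.I * (w.im • Polynomial.aeval z g) =
          w * Polynomial.aeval z g := by
        conv_rhs => rw [← Complex.re_add_im w]
        simp only [Complex.real_smul]
        ring
      rw [this, hw, inv_mul_cancel₀ hgz]
    · simpa [hg0] using hε

theorem carleman_of_sq_le {u v : ℕ → ℝ} (hu : ∀ n, 0 ≤ u n)
    (hlc : ∀ n, u (n + 1) ^ 2 ≤ u n * u (n + 2)) (hv : ∀ n, 0 ≤ v n) {C : ℝ}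
    (hvu : ∀ n, v n ^ 2 ≤ C * u (2 * n))
    (hC : ∑' n : ℕ, (ENNReal.ofReal (u (n + 1))) ^ (-(1 / (2 * ((n : ℝ) + 1)))) = ⊤) :
    ∑' n : ℕ, (ENNReal.ofReal (v (n + 1))) ^ (-(1 / (2 * ((n : ℝ) + 1)))) = ⊤ := by
  have hcast : ∀ n : ℕ, (0 : ℝ) ≤ n := fun n => Nat.cast_nonneg n
  by_cases hz : ∃ n, v (n + 1) = 0
  · obtain ⟨n, hn⟩ := hz
    refine ENNReal.tsum_eq_top_of_eq_top ⟨n, ?_⟩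
    rw [hn, ENNReal.ofReal_zero, ENNReal.zero_rpow_of_neg]
    have := hcast n
    have : 0 < 1 / (2 * ((n : ℝ) + 1)) := by positivity
    linarith
  push Not at hz
  have hvpos : ∀ n, 0 < v (n + 1) := fun n => lt_of_le_of_ne (hv _) (hz n).symm
  have hupos : ∀ n, 0 < u n := by
    intro n
    refine lt_of_le_of_ne (hu n) fun h0 => ?_
    have hprop : ∀ k, u (n + k) = 0 := by
      intro k
      induction k with
      | zero => exact h0.symm
      | succ k ih =>
        have := hlc (n + k)
        rw [ih, zero_mul] at this
        exact pow_eq_zero_iff (two_ne_zero) |>.mp (le_antisymm this (sq_nonneg _))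
    have h1 := hvu (n + 1)
    rw [show 2 * (n + 1) = n + (n + 2) by ring, hprop, mul_zero] at h1
    have := hvpos n
    nlinarith
  by_contra hfin
  set a : ℕ → ℝ := fun m => u m ^ (-(1 / (2 * (m : ℝ)))) with ha
  have ha0 : ∀ m, 0 ≤ a m := fun m => Real.rpow_nonneg (hu m) _
  have hvs : Summable fun n : ℕ => v (n + 1) ^ (-(1 / (2 * ((n : ℝ) + 1)))) := by
    have := ENNReal.summable_toReal hfin
    refine this.congr fun n => ?_
    rw [ENNReal.ofReal_rpow_of_pos (hvpos n), ENNReal.toReal_ofReal]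
    exact Real.rpow_nonneg (hv _) _
  set C₁ : ℝ := max 1 C with hC₁
  have hC1 : 1 ≤ C₁ := le_max_left _ _
  have heven : ∀ n, a (2 * n + 2) ≤ C₁ * v (n + 1) ^ (-(1 / (2 * ((n : ℝ) + 1)))) := by
    intro n
    have hn := hcast n
    have hU := hupos (2 * n + 2)
    have h1 : v (n + 1) ^ 2 ≤ C₁ * u (2 * n + 2) :=
      (hvu (n + 1)).trans (by
        rw [show 2 * (n + 1) = 2 * n + 2 by ring]
        gcongr
        exact le_max_right _ _)
    set r : ℝ := 1 / (2 * ((2 * n + 2 : ℕ) : ℝ)) with hr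
    have hr0 : 0 ≤ r := by positivity
    have hr1 : r ≤ 1 := by
      rw [hr, div_le_one (by positivity)]; push_cast; linarith
    have e1 : v (n + 1) ^ (-(1 / (2 * ((n : ℝ) + 1)))) = (v (n + 1) ^ 2) ^ (-r) := by
      rw [← Real.rpow_natCast, ← Real.rpow_mul (hv _)]
      congr 1
      rw [hr]; push_cast; field_simp
      try ring
    have h2 : (C₁ * u (2 * n + 2)) ^ (-r) ≤ (v (n + 1) ^ 2) ^ (-r) :=
      Real.rpow_le_rpow_of_nonpos (pow_pos (hvpos n) 2) h1 (by linarith)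
    rw [e1]
    have hC1' : 0 < C₁ := by linarith
    calc a (2 * n + 2) = C₁ ^ r * (C₁ * u (2 * n + 2)) ^ (-r) := by
          rw [Real.mul_rpow hC1'.le hU.le, ← mul_assoc, ← Real.rpow_add hC1']
          simp [ha, hr]
      _ ≤ C₁ * (v (n + 1) ^ 2) ^ (-r) := by
        gcongr
        · calc C₁ ^ r ≤ C₁ ^ (1 : ℝ) := Real.rpow_le_rpow_of_exponent_le hC1 hr1
            _ = C₁ := Real.rpow_one _
  have hratio : ∀ k, u k ^ (k + 1) ≤ u (k + 1) ^ k * u 0 := by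
    intro k
    induction k with
    | zero => simp
    | succ k ih =>
      have h1 := hlc k
      have hp := pow_pos (hupos (k + 1)) k
      have h2 : u (k + 1) ^ k * u (k + 1) ^ (k + 2) ≤
          u (k + 1) ^ k * (u (k + 2) ^ (k + 1) * u 0) := by
        calc u (k + 1) ^ k * u (k + 1) ^ (k + 2) = (u (k + 1) ^ 2) ^ (k + 1) := by ring
          _ ≤ (u k * u (k + 2)) ^ (k + 1) := by gcongr
          _ = u k ^ (k + 1) * u (k + 2) ^ (k + 1) := by ring
          _ ≤ (u (k + 1) ^ k * u 0) * u (k + 2) ^ (k + 1) := by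
            gcongr
            exact pow_nonneg (hu _) _
          _ = _ := by ring
      exact le_of_mul_le_mul_left h2 hp
  set K : ℝ := max 1 (u 0) with hK
  have hK1 : 1 ≤ K := le_max_left _ _
  have hodd : ∀ n, a (2 * n + 3) ≤ K * a (2 * n + 2) := by
    intro n
    have hn := hcast n
    have h1 := hratio (2 * n + 2)
    have hk : ((2 * n + 2 : ℕ) : ℝ) = 2 * n + 2 := by push_cast; ring
    have hk3 : ((2 * n + 3 : ℕ) : ℝ) = 2 * n + 3 := by push_cast; ring
    set r : ℝ := 1 / (2 * ((2 * n + 2 : ℝ) * (2 * n + 3))) with hr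
    have hr0 : 0 ≤ r := by positivity
    have hr1 : r ≤ 1 := by
      rw [hr, div_le_one (by positivity)]; nlinarith
    have hU2 := hupos (2 * n + 2)
    have hU3 := hupos (2 * n + 3)
    have h2 := Real.rpow_le_rpow_of_nonpos (pow_pos hU2 _) h1 (z := -r) (by linarith)
    rw [Real.mul_rpow (by positivity) (hu 0), ← Real.rpow_natCast, ← Real.rpow_natCast,
      ← Real.rpow_mul hU2.le, ← Real.rpow_mul (hu _)] at h2
    have e1 : ((2 * n + 2 : ℕ) : ℝ) * -r = -(1 / (2 * ((2 * n + 3 : ℕ) : ℝ))) := by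
      rw [hk, hk3, hr]; field_simp
    have e2 : ((2 * n + 2 + 1 : ℕ) : ℝ) * -r = -(1 / (2 * ((2 * n + 2 : ℕ) : ℝ))) := by
      rw [show 2 * n + 2 + 1 = 2 * n + 3 by ring, hk, hk3, hr]; field_simp
    rw [e1, e2] at h2
    have hu0 := hupos 0
    calc a (2 * n + 3) = u 0 ^ r * (a (2 * n + 3) * u 0 ^ (-r)) := by
          rw [mul_comm (a _), ← mul_assoc, ← Real.rpow_add hu0]; simp
      _ ≤ K * a (2 * n + 2) := by
        gcongr
        · calc u 0 ^ r ≤ K ^ r := by gcongr; exact le_max_right _ _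
            _ ≤ K ^ (1 : ℝ) := Real.rpow_le_rpow_of_exponent_le hK1 hr1
            _ = K := Real.rpow_one _
  have hse : Summable fun n => a (2 * n + 2) :=
    Summable.of_nonneg_of_le (fun n => ha0 _) heven (hvs.mul_left _)
  have hso : Summable fun n => a (2 * n + 3) :=
    Summable.of_nonneg_of_le (fun n => ha0 _) hodd (hse.mul_left _)
  have hall : Summable fun n => a (n + 2) :=
    Summable.even_add_odd (f := fun n => a (n + 2)) hse hso
  have hall' : Summable fun n => a (n + 1) :=
    (summable_nat_add_iff (f := fun n => a (n + 1)) 1).mp hall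
  refine hall'.tsum_ofReal_ne_top (Eq.trans (tsum_congr fun n => ?_) hC)
  rw [ENNReal.ofReal_rpow_of_pos (hupos _)]
  simp [ha]

theorem carleman_weight {B : Type*} [CommRing B] [Algebra ℝ B] (M : B →ₗ[ℝ] ℝ)
    (hM : ∀ u, 0 ≤ M (u * u)) (g w : B) (hw : ∀ u, 0 ≤ M (w * (u * u)))
    (hC : ∑' n : ℕ, (ENNReal.ofReal (M (g ^ (2 * (n + 1)))))
      ^ (-(1 / (2 * ((n : ℝ) + 1)))) = ⊤) :
    ∑' n : ℕ, (ENNReal.ofReal (M (w * g ^ (2 * (n + 1)))))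
      ^ (-(1 / (2 * ((n : ℝ) + 1)))) = ⊤ := by
  refine carleman_of_sq_le (u := fun n => M (g ^ (2 * n))) (v := fun n => M (w * g ^ (2 * n)))
    (C := M (w * w)) (fun n => ?_) (fun n => ?_) (fun n => ?_) (fun n => ?_) hC
  · rw [two_mul, pow_add]; exact hM _
  · have := sq_map_mul_le M hM (g ^ n) (g ^ (n + 2))
    ring_nf at this ⊢
    exact this
  · rw [two_mul, pow_add]; exact hw _
  · have := sq_map_mul_le M hM w (g ^ (2 * n))
    rwa [← pow_add, ← two_mul] at this

theorem exists_small_of_carleman_weight {B : Type*} [CommRing B] [Algebra ℝ B] (M : B →ₗ[ℝ] ℝ)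
    (hM : ∀ u, 0 ≤ M (u * u)) (g w : B) (hw : ∀ u, 0 ≤ M (w * (u * u)))
    (hC : ∑' n : ℕ, (ENNReal.ofReal (M (g ^ (2 * (n + 1)))))
      ^ (-(1 / (2 * ((n : ℝ) + 1)))) = ⊤) (z : ℂ) (hz : z.im ≠ 0) {ε : ℝ} (hε : 0 < ε) :
    ∃ a b : Polynomial ℝ, Polynomial.aeval z a + Complex.I * Polynomial.aeval z b = 1 ∧
      M (w * (Polynomial.aeval g a * Polynomial.aeval g a +
        Polynomial.aeval g b * Polynomial.aeval g b)) < ε := by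
  obtain ⟨a, b, h1, h2⟩ := exists_small_of_carleman
    (M ∘ₗ LinearMap.mulLeft ℝ w ∘ₗ (Polynomial.aeval g).toLinearMap)
    (fun q => by simpa using hw (Polynomial.aeval g q)) z hz
    (by simpa using carleman_weight M hM g w hw hC) hε
  exact ⟨a, b, h1, by simpa using h2⟩

theorem Polynomial.eq_expand_two_add (h : Polynomial ℝ) :
    h = Polynomial.expand ℝ 2 (h.contract 2) +
      Polynomial.X * Polynomial.expand ℝ 2 (h.divX.contract 2) := by
  ext n
  rcases Nat.even_or_odd' n with ⟨k, rfl | rfl⟩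
  · rw [Polynomial.coeff_add, Polynomial.coeff_expand_mul' two_pos,
      Polynomial.coeff_contract two_ne_zero]
    rcases k with _ | k
    · simp
    · rw [show 2 * (k + 1) = (2 * k + 1) + 1 by ring, Polynomial.coeff_X_mul,
        Polynomial.coeff_expand two_pos, if_neg (by omega), add_zero]
      congr 1; ring
  · rw [Polynomial.coeff_add, Polynomial.coeff_X_mul, Polynomial.coeff_expand_mul' two_pos,
      Polynomial.coeff_contract two_ne_zero, Polynomial.coeff_divX, Polynomial.coeff_expand two_pos,
      if_neg (by omega), zero_add]
    congr 1; ring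

/-- Adjoining a square root of `f` turns the Stieltjes condition at `f` into the Carleman
condition at the root; returning to `A` keeps the even part of the approximating polynomial. -/
theorem exists_small_of_stieltjes {A : Type*} [CommRing A] [Algebra ℝ A] (L : A →ₗ[ℝ] ℝ)
    (hL : ∀ a, 0 ≤ L (a * a)) (f : A) (hf : ∀ a, 0 ≤ L (f * (a * a)))
    (hC : ∑' n : ℕ, (ENNReal.ofReal (L (f ^ (n + 1)))) ^ (-(1 / (2 * ((n : ℝ) + 1)))) = ⊤)
    (p : A) (z : ℂ) (hz : z.im ≠ 0) (α β : Polynomial ℝ)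
    (hαβ : Polynomial.aeval z β = Complex.I * Polynomial.aeval z α) {ε : ℝ} (hε : 0 < ε) :
    ∃ a b h₀ : Polynomial ℝ, Polynomial.aeval z (α * a + β * b) = Polynomial.aeval z α ∧
      2 * Polynomial.aeval (z ^ 2) h₀ =
        Polynomial.aeval z (α * a + β * b) + Polynomial.aeval (-z) (α * a + β * b) ∧
      L ((p * Polynomial.aeval f h₀) * (p * Polynomial.aeval f h₀)) < ε := by
  let B := QuadraticAlgebra A f 0
  let re : B →ₗ[ℝ] A := { toFun := fun u => u.re, map_add' := fun _ _ => rfl,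
                          map_smul' := fun _ _ => rfl }
  let ω : B := QuadraticAlgebra.omega
  have hω : ω * ω = algebraMap A B f := by
    simpa using QuadraticAlgebra.omega_mul_omega_eq_algebraMap (a := f) (b := (0 : A))
  let M : B →ₗ[ℝ] ℝ := L ∘ₗ re
  have hMre : ∀ u : B, M u = L u.re := fun _ => rfl
  have hre : ∀ u : A, (algebraMap A B u).re = u := fun _ => rfl
  have hMu : ∀ u : B, M (u * u) = L (u.re * u.re) + L (f * (u.im * u.im)) := by
    intro u
    rw [hMre, QuadraticAlgebra.re_mul, map_add]
    congr 2; ring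
  have hM : ∀ u, 0 ≤ M (u * u) := fun u => by rw [hMu]; exact add_nonneg (hL _) (hf _)
  set x : B := algebraMap A B p with hx
  set A₁ := Polynomial.aeval ω α with hA₁
  set B₁ := Polynomial.aeval ω β with hB₁
  have hw : ∀ u, 0 ≤ M (x * x * (A₁ * A₁ + B₁ * B₁) * (u * u)) := by
    intro u
    have e : x * x * (A₁ * A₁ + B₁ * B₁) * (u * u) =
      (x * A₁ * u) * (x * A₁ * u) + (x * B₁ * u) * (x * B₁ * u) := by ring
    rw [e, map_add]
    exact add_nonneg (hM _) (hM _)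
  have hωpow : ∀ n, ω ^ (2 * n) = algebraMap A B (f ^ n) := by
    intro n; rw [pow_mul, pow_two, hω, map_pow]
  obtain ⟨a, b, hab, hlt⟩ := exists_small_of_carleman_weight M hM ω _ hw
    (by simp_rw [hωpow, hMre, hre]; exact hC) z hz hε
  set h := α * a + β * b with hh
  refine ⟨a, b, h.contract 2, ?_, ?_, ?_⟩
  · rw [map_add, map_mul, map_mul, hαβ]
    linear_combination (Polynomial.aeval z α) * hab
  · have e := h.eq_expand_two_add
    have e1 := congrArg (Polynomial.aeval z) e
    have e2 := congrArg (Polynomial.aeval (-z)) e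
    simp only [map_add, map_mul, Polynomial.expand_aeval, Polynomial.aeval_X, neg_sq] at e1 e2
    rw [e1, e2]; ring
  · refine lt_of_le_of_lt ?_ hlt
    have e := congrArg (Polynomial.aeval ω) h.eq_expand_two_add
    simp only [map_add, map_mul, Polynomial.expand_aeval, Polynomial.aeval_X] at e
    rw [pow_two, hω, Polynomial.aeval_algebraMap_apply, Polynomial.aeval_algebraMap_apply] at e
    have h1 : L ((p * Polynomial.aeval f (h.contract 2)) * (p * Polynomial.aeval f (h.contract 2)))
        ≤ M ((x * Polynomial.aeval ω h) * (x * Polynomial.aeval ω h)) := by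
      rw [hMu]
      have : (x * Polynomial.aeval ω h).re = p * Polynomial.aeval f (h.contract 2) := by
        have him : ∀ u : A, (algebraMap A B u).im = 0 := fun _ => rfl
        rw [e, hx, mul_add, ← map_mul, mul_left_comm, ← map_mul, QuadraticAlgebra.re_add, hre,
          QuadraticAlgebra.re_mul, hre, him, QuadraticAlgebra.omega_re]
        ring
      rw [this]
      linarith [hf (x * Polynomial.aeval ω h).im]
    refine h1.trans ?_
    have e3 : x * x * (A₁ * A₁ + B₁ * B₁) * (Polynomial.aeval ω a * Polynomial.aeval ω a +
        Polynomial.aeval ω b * Polynomial.aeval ω b) =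
        (x * Polynomial.aeval ω h) * (x * Polynomial.aeval ω h) +
        (x * (A₁ * Polynomial.aeval ω b - B₁ * Polynomial.aeval ω a)) *
        (x * (A₁ * Polynomial.aeval ω b - B₁ * Polynomial.aeval ω a)) := by
      rw [hh, map_add, map_mul, map_mul]; ring
    rw [e3, map_add M]
    linarith [hM (x * (A₁ * Polynomial.aeval ω b - B₁ * Polynomial.aeval ω a))]

theorem exists_one_add_mul_approx {A : Type*} [CommRing A] [Algebra ℝ A] (L : A →ₗ[ℝ] ℝ)
    (hL : ∀ a, 0 ≤ L (a * a)) (f : A) (hf : ∀ a, 0 ≤ L (f * (a * a)))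
    (hC : ∑' n : ℕ, (ENNReal.ofReal (L (f ^ (n + 1)))) ^ (-(1 / (2 * ((n : ℝ) + 1)))) = ⊤)
    (p : A) {ε : ℝ} (hε : 0 < ε) :
    ∃ Q : Polynomial ℝ, L ((p - (1 + f) * Polynomial.aeval f Q * p) *
      (p - (1 + f) * Polynomial.aeval f Q * p)) < ε := by
  obtain ⟨a, b, h₀, h1, h2, h3⟩ := exists_small_of_stieltjes L hL f hf hC p Complex.I (by simp)
    1 Polynomial.X (by simp) hε
  have h4 : Polynomial.aeval (-Complex.I) (1 * a + Polynomial.X * b) = 1 := by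
    have := congrArg (starRingEnd ℂ) h1
    rw [← Polynomial.aeval_conj] at this
    simpa using this
  rw [h1, h4, Complex.I_sq] at h2
  have h5 : Polynomial.eval (-1) h₀ = 1 := by
    have h6 : Polynomial.aeval (-1 : ℂ) h₀ = ((Polynomial.eval (-1) h₀ : ℝ) : ℂ) := by
      have := Polynomial.aeval_algebraMap_apply ℂ (-1 : ℝ) h₀
      simpa using this
    rw [h6, map_one] at h2
    have h7 : (2 * Polynomial.eval (-1) h₀ : ℝ) = 1 + 1 := by exact_mod_cast h2
    linarith
  obtain ⟨Q, hQ⟩ := Polynomial.dvd_iff_isRoot.mpr (show (1 - h₀).IsRoot (-1) by simp [h5])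
  refine ⟨Q, ?_⟩
  have h7 := congrArg (Polynomial.aeval f) hQ
  simp only [map_sub, map_mul, map_one, Polynomial.aeval_X, map_neg, sub_neg_eq_add, map_add] at h7
  have h8 : p - (1 + f) * Polynomial.aeval f Q * p = p * Polynomial.aeval f h₀ := by
    linear_combination p * h7
  rwa [h8]

theorem exists_one_add_sq_mul_approx {A : Type*} [CommRing A] [Algebra ℝ A] (L : A →ₗ[ℝ] ℝ)
    (hL : ∀ a, 0 ≤ L (a * a)) (f : A) (hf : ∀ a, 0 ≤ L (f * (a * a)))
    (hC : ∑' n : ℕ, (ENNReal.ofReal (L (f ^ (n + 1)))) ^ (-(1 / (2 * ((n : ℝ) + 1)))) = ⊤)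
    (p : A) {ε : ℝ} (hε : 0 < ε) :
    ∃ Q : Polynomial ℝ, L ((p - (1 + f ^ 2) * Polynomial.aeval f Q * p) *
      (p - (1 + f ^ 2) * Polynomial.aeval f Q * p)) < ε := by
  obtain ⟨s, hs0, hs⟩ : ∃ s : ℝ, 0 < s ∧ s * s = 2 := ⟨√2, by positivity, by simp⟩
  have hsC : (s : ℂ) * s = 2 := by exact_mod_cast hs
  have hI := Complex.I_mul_I
  set z : ℂ := (s / 2 : ℝ) * (1 + Complex.I) with hz
  have hz2 : z ^ 2 = Complex.I := by
    rw [hz]; push_cast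
    linear_combination (1 / 4) * (1 + Complex.I) ^ 2 * hsC + (1 / 2) * hI
  let D : Polynomial ℝ := Polynomial.X ^ 2 + Polynomial.C s * Polynomial.X + 1
  let α : Polynomial ℝ := Polynomial.C s * (Polynomial.C s - Polynomial.X) * D
  let β : Polynomial ℝ := Polynomial.C s * Polynomial.X * D
  have hβα : Polynomial.aeval z β = Complex.I * Polynomial.aeval z α := by
    simp only [α, β, map_mul, map_sub, Polynomial.aeval_X, Polynomial.aeval_C,
      Complex.coe_algebraMap]
    have : z = Complex.I * (s - z) := by
      rw [hz]; push_cast; linear_combination (s / 2) * hI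
    linear_combination (s * Polynomial.aeval z D) * this
  have hαz : Polynomial.aeval z α = 4 := by
    simp only [α, D, map_mul, map_sub, map_add, map_pow, map_one, Polynomial.aeval_X,
      Polynomial.aeval_C, Complex.coe_algebraMap, hz2]
    have h1 : (s : ℂ) * (s - z) = 1 - Complex.I := by
      rw [hz]; push_cast; linear_combination ((1 - Complex.I) / 2) * hsC
    have h2 : (s : ℂ) * z = 1 + Complex.I := by
      rw [hz]; push_cast; linear_combination ((1 + Complex.I) / 2) * hsC
    rw [h1, h2]
    linear_combination (-2) * hI
  have hDz : Polynomial.aeval (-z) D = 0 := by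
    simp only [D, map_mul, map_add, map_pow, map_one, Polynomial.aeval_X,
      Polynomial.aeval_C, Complex.coe_algebraMap, neg_sq, hz2]
    rw [hz]; push_cast
    linear_combination (-(1 + Complex.I) / 2) * hsC
  obtain ⟨a, b, h₀, h1, h2, h3⟩ := exists_small_of_stieltjes
    L hL f hf hC p z (by simp [hz, hs0.ne'])
    α β hβα (ε := 4 * ε) (by positivity)
  rw [h1, hz2, hαz] at h2
  have h4 : Polynomial.aeval (-z) (α * a + β * b) = 0 := by
    simp only [α, β, map_add, map_mul, hDz]; ring
  rw [h4] at h2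
  have h5 : Polynomial.aeval Complex.I (2 - h₀) = 0 := by
    rw [map_sub, map_ofNat]; linear_combination (-1 / 2) * h2
  obtain ⟨Q, hQ⟩ := Polynomial.quadratic_dvd_of_aeval_eq_zero_im_ne_zero _ h5 (by simp)
  refine ⟨Polynomial.C (1 / 2) * Q, ?_⟩
  have h7 := congrArg (Polynomial.aeval f) hQ
  simp only [map_sub, map_mul, map_one, Polynomial.aeval_X, map_ofNat, map_pow,
    map_add, Complex.I_re, mul_zero, map_zero, zero_mul, sub_zero, Complex.norm_I, one_pow] at h7
  have h8 : p - (1 + f ^ 2) * Polynomial.aeval f (Polynomial.C (1 / 2) * Q) * p =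
      (1 / 2 : ℝ) • (p * Polynomial.aeval f h₀) := by
    have h9 : (2 : A) * algebraMap ℝ A (1 / 2) = 1 := by
      rw [← map_ofNat (algebraMap ℝ A) 2, ← map_mul]; norm_num
    rw [Algebra.smul_def, map_mul, Polynomial.aeval_C]
    linear_combination (p * algebraMap ℝ A (1 / 2)) * h7 - p * h9
  rw [h8, smul_mul_smul_comm, map_smul, smul_eq_mul]
  linarith

/-- Multiplication by `u` maps polynomials into the `L²(μ)`-closure of the polynomials. -/
def PreservesPolyClosure {d : ℕ} (μ : Measure (Fin d → ℝ)) (u : (Fin d → ℝ) → ℝ) : Prop :=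
  ∀ (p : MvPolynomial (Fin d) ℝ) (ε : ℝ), 0 < ε →
    ∃ q : MvPolynomial (Fin d) ℝ, ∫ x, (u x * eval x p - eval x q) ^ 2 ∂μ < ε

section PolyClosure

variable {d : ℕ} {μ : Measure (Fin d → ℝ)}

theorem integrable_boundedContinuous_mul_eval
    (hμ : ∀ p : MvPolynomial (Fin d) ℝ, Integrable (fun x => eval x p) μ)
    (u : BoundedContinuousFunction (Fin d → ℝ) ℝ) (p : MvPolynomial (Fin d) ℝ) :
    Integrable (fun x => u x * eval x p) μ :=
  (hμ p).bdd_mul (c := ‖u‖) u.continuous.aestronglyMeasurable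
    (Filter.Eventually.of_forall fun x => u.norm_coe_le_norm x)

theorem integrable_sq_boundedContinuous_mul_eval_sub
    (hμ : ∀ p : MvPolynomial (Fin d) ℝ, Integrable (fun x => eval x p) μ)
    (u : BoundedContinuousFunction (Fin d → ℝ) ℝ) (p q : MvPolynomial (Fin d) ℝ) :
    Integrable (fun x => (u x * eval x p - eval x q) ^ 2) μ := by
  refine (((integrable_boundedContinuous_mul_eval hμ (u * u) (p * p)).sub
    (integrable_boundedContinuous_mul_eval hμ u (2 * p * q))).add (hμ (q * q))).congr
    (Filter.Eventually.of_forall fun x => ?_)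
  simp; ring

theorem PreservesPolyClosure.const (c : ℝ) : PreservesPolyClosure μ fun _ => c :=
  fun p ε hε => ⟨C c * p, by simpa using hε⟩

theorem PreservesPolyClosure.add
    (hμ : ∀ p : MvPolynomial (Fin d) ℝ, Integrable (fun x => eval x p) μ)
    {u v : BoundedContinuousFunction (Fin d → ℝ) ℝ} (hu : PreservesPolyClosure μ u)
    (hv : PreservesPolyClosure μ v) : PreservesPolyClosure μ fun x => u x + v x := by
  intro p ε hε
  obtain ⟨q, hq⟩ := hu p (ε / 4) (by positivity)
  obtain ⟨r, hr⟩ := hv p (ε / 4) (by positivity)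
  refine ⟨q + r, ?_⟩
  have iq := (integrable_sq_boundedContinuous_mul_eval_sub hμ u p q).const_mul 2
  have ir := (integrable_sq_boundedContinuous_mul_eval_sub hμ v p r).const_mul 2
  calc ∫ x, ((u x + v x) * eval x p - eval x (q + r)) ^ 2 ∂μ
      ≤ ∫ x, (2 * (u x * eval x p - eval x q) ^ 2 + 2 * (v x * eval x p - eval x r) ^ 2) ∂μ := by
        refine integral_mono (integrable_sq_boundedContinuous_mul_eval_sub hμ (u + v) p (q + r))
          (iq.add ir) fun x => ?_
        simp only [map_add]
        nlinarith [sq_nonneg ((u x * eval x p - eval x q) - (v x * eval x p - eval x r))]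
    _ < ε := by
        rw [integral_add iq ir, integral_const_mul, integral_const_mul]; linarith

theorem PreservesPolyClosure.mul
    (hμ : ∀ p : MvPolynomial (Fin d) ℝ, Integrable (fun x => eval x p) μ)
    {u v : BoundedContinuousFunction (Fin d → ℝ) ℝ} (hu : PreservesPolyClosure μ u)
    (hv : PreservesPolyClosure μ v) : PreservesPolyClosure μ fun x => u x * v x := by
  intro p ε hε
  have hK : 0 < 4 * (‖u‖ ^ 2 + 1) := by positivity
  obtain ⟨q, hq⟩ := hv p (ε / (4 * (‖u‖ ^ 2 + 1))) (by positivity)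
  obtain ⟨r, hr⟩ := hu q (ε / 4) (by positivity)
  refine ⟨r, ?_⟩
  have iq := (integrable_sq_boundedContinuous_mul_eval_sub hμ v p q).const_mul
    (2 * (‖u‖ ^ 2 + 1))
  have ir := (integrable_sq_boundedContinuous_mul_eval_sub hμ u q r).const_mul 2
  calc ∫ x, (u x * v x * eval x p - eval x r) ^ 2 ∂μ
      ≤ ∫ x, (2 * (‖u‖ ^ 2 + 1) * (v x * eval x p - eval x q) ^ 2 +
          2 * (u x * eval x q - eval x r) ^ 2) ∂μ := by
        refine integral_mono (integrable_sq_boundedContinuous_mul_eval_sub hμ (u * v) p r)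
          (iq.add ir) fun x => ?_
        have h1 : u x ^ 2 ≤ ‖u‖ ^ 2 + 1 := by
          have := u.norm_coe_le_norm x
          rw [Real.norm_eq_abs] at this
          have := sq_le_sq' (by linarith [neg_abs_le (u x)]) ((le_abs_self _).trans this)
          linarith
        have h2 := mul_le_mul_of_nonneg_right h1 (sq_nonneg (v x * eval x p - eval x q))
        nlinarith [sq_nonneg (u x * (v x * eval x p - eval x q) - (u x * eval x q - eval x r))]
    _ < ε := by
        rw [integral_add iq ir, integral_const_mul, integral_const_mul]
        have := (lt_div_iff₀ hK).mp hq
        linarith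

theorem PreservesPolyClosure.one_add_sq_inv
    (hμ : ∀ p : MvPolynomial (Fin d) ℝ, Integrable (fun x => eval x p) μ)
    (f : MvPolynomial (Fin d) ℝ)
    (hf : ∀ (p : MvPolynomial (Fin d) ℝ) (ε : ℝ), 0 < ε → ∃ q : MvPolynomial (Fin d) ℝ,
      ∫ x, eval x ((p - (1 + f ^ 2) * q) * (p - (1 + f ^ 2) * q)) ∂μ < ε) :
    PreservesPolyClosure μ fun x => (1 + eval x f ^ 2)⁻¹ := by
  intro p ε hε
  obtain ⟨q, hq⟩ := hf p ε hε
  refine ⟨q, lt_of_le_of_lt (integral_mono_of_nonneg (Filter.Eventually.of_forall fun x =>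
    sq_nonneg _) (hμ _) (Filter.Eventually.of_forall fun x => ?_)) hq⟩
  have h0 : 1 ≤ 1 + eval x f ^ 2 := by nlinarith [sq_nonneg (eval x f)]
  have e : (1 + eval x f ^ 2)⁻¹ * eval x p - eval x q =
      (1 + eval x f ^ 2)⁻¹ * eval x (p - (1 + f ^ 2) * q) := by
    simp only [map_sub, map_mul, map_add, map_one, map_pow]
    field_simp
  have h1 : (1 + eval x f ^ 2)⁻¹ ^ 2 ≤ 1 := pow_le_one₀ (by positivity) (inv_le_one_of_one_le₀ h0)
  simp only [e]
  rw [map_mul, mul_pow, ← pow_two]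
  exact mul_le_of_le_one_left (sq_nonneg _) h1

theorem PreservesPolyClosure.mul_one_add_sq_inv {f : MvPolynomial (Fin d) ℝ}
    (hf : PreservesPolyClosure μ fun x => (1 + eval x f ^ 2)⁻¹) :
    PreservesPolyClosure μ fun x => eval x f * (1 + eval x f ^ 2)⁻¹ := by
  intro p ε hε
  obtain ⟨q, hq⟩ := hf (f * p) ε hε
  refine ⟨q, ?_⟩
  convert hq using 5
  rw [map_mul]; ring

end PolyClosure

theorem integral_eq_of_preservesPolyClosure {d : ℕ} {μ₁ μ₂ : Measure (Fin d → ℝ)}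
    (h₁ : ∀ p : MvPolynomial (Fin d) ℝ, Integrable (fun x => eval x p) μ₁)
    (h₂ : ∀ p : MvPolynomial (Fin d) ℝ, Integrable (fun x => eval x p) μ₂)
    (h : ∀ p : MvPolynomial (Fin d) ℝ, ∫ x, eval x p ∂μ₁ = ∫ x, eval x p ∂μ₂)
    (u : BoundedContinuousFunction (Fin d → ℝ) ℝ) (hu : PreservesPolyClosure (μ₁ + μ₂) u) :
    ∫ x, u x ∂μ₁ = ∫ x, u x ∂μ₂ := by
  have hμ : ∀ p : MvPolynomial (Fin d) ℝ, Integrable (fun x => eval x p) (μ₁ + μ₂) :=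
    fun p => (h₁ p).add_measure (h₂ p)
  have i₁ : Integrable (fun x => u x) μ₁ := by
    simpa using integrable_boundedContinuous_mul_eval h₁ u 1
  have i₂ : Integrable (fun x => u x) μ₂ := by
    simpa using integrable_boundedContinuous_mul_eval h₂ u 1
  set K := ∫ x, eval x (1 : MvPolynomial (Fin d) ℝ) ∂(μ₁ + μ₂) with hK
  have hK0 : 0 ≤ K := integral_nonneg fun x => by simp
  have key : ∀ δ : ℝ, 0 < δ → |∫ x, u x ∂μ₁ - ∫ x, u x ∂μ₂| ≤ δ * (K + 1) := by
    intro δ hδ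
    obtain ⟨q, hq⟩ := hu 1 (δ ^ 2) (by positivity)
    have iq := integrable_sq_boundedContinuous_mul_eval_sub hμ u 1 q
    have ia : Integrable (fun x => |u x - eval x q|) (μ₁ + μ₂) :=
      ((i₁.add_measure i₂).sub (hμ q)).abs
    have e : ∫ x, u x ∂μ₁ - ∫ x, u x ∂μ₂ =
        ∫ x, (u x - eval x q) ∂μ₁ - ∫ x, (u x - eval x q) ∂μ₂ := by
      rw [integral_sub i₁ (h₁ q), integral_sub i₂ (h₂ q), h q]; ring
    calc |∫ x, u x ∂μ₁ - ∫ x, u x ∂μ₂|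
        ≤ |∫ x, (u x - eval x q) ∂μ₁| + |∫ x, (u x - eval x q) ∂μ₂| := by
          rw [e]; exact abs_sub _ _
      _ ≤ ∫ x, |u x - eval x q| ∂μ₁ + ∫ x, |u x - eval x q| ∂μ₂ :=
          add_le_add (abs_integral_le_integral_abs) (abs_integral_le_integral_abs)
      _ = ∫ x, |u x - eval x q| ∂(μ₁ + μ₂) :=
          (integral_add_measure ia.left_of_add_measure ia.right_of_add_measure).symm
      _ ≤ ∫ x, (δ * eval x (1 : MvPolynomial (Fin d) ℝ) +
            δ⁻¹ * (u x * eval x (1 : MvPolynomial (Fin d) ℝ) - eval x q) ^ 2) ∂(μ₁ + μ₂) := by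
          refine integral_mono ia (((hμ 1).const_mul δ).add (iq.const_mul δ⁻¹)) fun x => ?_
          simp only [map_one, mul_one]
          rw [← sq_abs (u x - eval x q)]
          have h3 : δ + δ⁻¹ * |u x - eval x q| ^ 2 - |u x - eval x q| =
            δ⁻¹ * ((δ - |u x - eval x q| / 2) ^ 2 + 3 / 4 * |u x - eval x q| ^ 2) := by
            field_simp; ring
          have h4 : 0 ≤ δ⁻¹ * ((δ - |u x - eval x q| / 2) ^ 2 + 3 / 4 * |u x - eval x q| ^ 2) := by
            positivity
          linarith
      _ ≤ δ * (K + 1) := by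
          rw [integral_add ((hμ 1).const_mul δ) (iq.const_mul δ⁻¹), integral_const_mul,
            integral_const_mul, ← hK]
          have : δ⁻¹ * ∫ x, (u x * eval x (1 : MvPolynomial (Fin d) ℝ) - eval x q) ^ 2 ∂(μ₁ + μ₂)
              ≤ δ⁻¹ * δ ^ 2 := by gcongr
          have e2 : δ⁻¹ * δ ^ 2 = δ := by field_simp
          linarith
  have h0 : |∫ x, u x ∂μ₁ - ∫ x, u x ∂μ₂| ≤ 0 := by
    refine le_of_forall_pos_le_add fun ε hε => ?_
    have := key (ε / (K + 1)) (by positivity)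
    rwa [div_mul_cancel₀ _ (by positivity), ← zero_add ε] at this
  exact sub_eq_zero.mp (abs_nonpos_iff.mp h0)

theorem eval_injective_of_adjoin_eq_top {d m : ℕ} {f : Fin m → MvPolynomial (Fin d) ℝ}
    (hgen : Algebra.adjoin ℝ (Set.range f) = ⊤) {x y : Fin d → ℝ}
    (h : ∀ j, eval x (f j) = eval y (f j)) : x = y := by
  have : aeval x = (aeval y : MvPolynomial (Fin d) ℝ →ₐ[ℝ] ℝ) := by
    refine AlgHom.ext_of_adjoin_eq_top hgen ?_
    rintro _ ⟨j, rfl⟩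
    simpa [aeval_eq_eval] using h j
  funext i
  simpa using DFunLike.congr_fun this (X i)

theorem measure_eq_of_moments_eq {d m : ℕ} {f : Fin m → MvPolynomial (Fin d) ℝ}
    (hgen : Algebra.adjoin ℝ (Set.range f) = ⊤) {μ₁ μ₂ : Measure (Fin d → ℝ)}
    (h₁ : ∀ p : MvPolynomial (Fin d) ℝ, Integrable (fun x => eval x p) μ₁)
    (h₂ : ∀ p : MvPolynomial (Fin d) ℝ, Integrable (fun x => eval x p) μ₂)
    (h : ∀ p : MvPolynomial (Fin d) ℝ, ∫ x, eval x p ∂μ₁ = ∫ x, eval x p ∂μ₂)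
    (hf : ∀ (j : Fin m) (p : MvPolynomial (Fin d) ℝ) (ε : ℝ), 0 < ε →
      ∃ q : MvPolynomial (Fin d) ℝ,
        ∫ x, eval x ((p - (1 + f j ^ 2) * q) * (p - (1 + f j ^ 2) * q)) ∂μ₁ < ε) :
    μ₁ = μ₂ := by
  have hμ : ∀ p : MvPolynomial (Fin d) ℝ, Integrable (fun x => eval x p) (μ₁ + μ₂) :=
    fun p => (h₁ p).add_measure (h₂ p)
  have : IsFiniteMeasure μ₁ := (integrable_const_iff_isFiniteMeasure (one_ne_zero (α := ℝ))).mp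
    (by simpa using h₁ 1)
  have : IsFiniteMeasure μ₂ := (integrable_const_iff_isFiniteMeasure (one_ne_zero (α := ℝ))).mp
    (by simpa using h₂ 1)
  have hinv : ∀ j, PreservesPolyClosure (μ₁ + μ₂) fun x => (1 + eval x (f j) ^ 2)⁻¹ := by
    intro j
    refine PreservesPolyClosure.one_add_sq_inv hμ (f j) fun p ε hε => ?_
    obtain ⟨q, hq⟩ := hf j p (ε / 2) (by positivity)
    refine ⟨q, ?_⟩
    rw [integral_add_measure (h₁ _) (h₂ _), ← h]
    linarith
  let 𝒮 : StarSubalgebra ℝ (BoundedContinuousFunction (Fin d → ℝ) ℝ) :=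
    { carrier := {u | PreservesPolyClosure (μ₁ + μ₂) u}
      mul_mem' := fun hu hv => PreservesPolyClosure.mul hμ hu hv
      add_mem' := fun hu hv => PreservesPolyClosure.add hμ hu hv
      algebraMap_mem' := fun c => PreservesPolyClosure.const c
      star_mem' := fun hu => hu }
  refine ext_of_forall_mem_subalgebra_integral_eq_of_polish (A := 𝒮) ?_
    fun u hu => integral_eq_of_preservesPolyClosure h₁ h₂ h u hu
  intro x y hxy
  by_contra hcon
  have hcon : ∀ u : BoundedContinuousFunction (Fin d → ℝ) ℝ,
      PreservesPolyClosure (μ₁ + μ₂) u → u x = u y := by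
    intro u hu
    by_contra hne
    exact hcon ⟨u, ⟨u.toContinuousMap, ⟨u, hu, rfl⟩, rfl⟩, hne⟩
  refine hxy (eval_injective_of_adjoin_eq_top hgen fun j => ?_)
  have hpos : ∀ x : Fin d → ℝ, 1 + eval x (f j) ^ 2 ≠ 0 := fun x => by positivity
  have hcont : Continuous fun x => (1 + eval x (f j) ^ 2)⁻¹ :=
    (continuous_const.add ((f j).continuous_eval.pow 2)).inv₀ hpos
  have e1 := hcon (BoundedContinuousFunction.ofNormedAddCommGroup _ hcont 1 fun x => by
    rw [norm_inv]
    refine inv_le_one_of_one_le₀ ?_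
    rw [Real.norm_of_nonneg (by positivity)]
    nlinarith [sq_nonneg (eval x (f j))]) (hinv j)
  have e2 := hcon (BoundedContinuousFunction.ofNormedAddCommGroup _
    ((f j).continuous_eval.mul hcont) 1 fun x => by
      rw [Pi.mul_apply, norm_mul, norm_inv, ← div_eq_mul_inv,
        div_le_one (norm_pos_iff.mpr (hpos x)),
        Real.norm_eq_abs, Real.norm_of_nonneg (by positivity), ← sq_abs]
      nlinarith [sq_nonneg (|eval x (f j)| - 1)]) (hinv j).mul_one_add_sq_inv
  simp only [BoundedContinuousFunction.coe_ofNormedAddCommGroup, Pi.mul_apply] at e1 e2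
  rw [e1] at e2
  exact mul_right_cancel₀ (inv_ne_zero (hpos y)) e2

/-- Commuting self-adjoint elements have a joint continuous functional calculus, on the Gelfand
spectrum of the C⋆-algebra they generate. -/
theorem exists_joint_calculus.{u, v} {B : Type u} [CStarAlgebra B] {ι : Type v} (R : ι → B)
    (hsa : ∀ i, IsSelfAdjoint (R i)) (hcomm : ∀ i j, R i * R j = R j * R i) :
    ∃ (X : Type u) (_ : TopologicalSpace X) (_ : CompactSpace X) (_ : T2Space X)
      (r : C(X, ι → ℝ)) (Ψ : C(X, ℂ) →⋆ₐ[ℂ] B),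
      ∀ i, Ψ ⟨fun x => (r x i : ℂ), by fun_prop⟩ = R i := by
  let s := Set.range R
  let S : StarSubalgebra ℂ B := StarAlgebra.adjoin ℂ s
  have hS : IsMulCommutative S := by
    refine StarAlgebra.isMulCommutative_adjoin ℂ ?_ ?_
    · rintro _ ⟨i, rfl⟩ _ ⟨j, rfl⟩; exact hcomm i j
    · rintro _ ⟨i, rfl⟩ _ ⟨j, rfl⟩; rw [(hsa j).star_eq]; exact hcomm i j
  let T : StarSubalgebra ℂ B := S.topologicalClosure
  have hT : ∀ a b : T, a * b = b * a :=
    (StarSubalgebra.commRingTopologicalClosure S fun x y => mul_comm' x y).mul_comm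
  let _ : NormedCommRing T := { SubringClass.toNormedRing T with mul_comm := hT }
  have : CompleteSpace T := isClosed_closure.completeSpace_coe
  let _ : CommCStarAlgebra T := { }
  have hR : ∀ i, R i ∈ T := fun i => StarSubalgebra.le_topologicalClosure _
    (StarAlgebra.subset_adjoin ℂ _ ⟨i, rfl⟩)
  let a : ι → T := fun i => ⟨R i, hR i⟩
  let Γ := gelfandStarTransform T
  refine ⟨WeakDual.characterSpace ℂ T, inferInstance, inferInstance, inferInstance,
    ⟨fun χ i => (Γ (a i) χ).re, by fun_prop⟩, T.subtype.comp (Γ.symm : _ →⋆ₐ[ℂ] T), fun i => ?_⟩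
  have ha : IsSelfAdjoint (Γ (a i)) := by
    have : IsSelfAdjoint (a i) := Subtype.ext (hsa i).star_eq
    exact this.map Γ
  have e : (⟨fun χ => (((Γ (a i) χ).re : ℝ) : ℂ), by fun_prop⟩ : C(_, ℂ)) = Γ (a i) := by
    ext χ
    exact Complex.conj_eq_iff_re.mp (congrArg (fun g : C(_, ℂ) => g χ) ha.star_eq)
  change ((Γ.symm _ : T) : B) = R i
  erw [e]
  rw [StarAlgEquiv.symm_apply_apply]

theorem exists_measure_of_positive {X : Type*} [TopologicalSpace X] [CompactSpace X] [T2Space X]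
    [MeasurableSpace X] [BorelSpace X] (Λ : C(X, ℝ) →ₗ[ℝ] ℝ)
    (hΛ : ∀ g, 0 ≤ g → 0 ≤ Λ g) :
    ∃ κ : Measure X, IsFiniteMeasure κ ∧ ∀ g : C(X, ℝ), ∫ x, g x ∂κ = Λ g := by
  let Λ' : CompactlySupportedContinuousMap X ℝ →ₚ[ℝ] ℝ := PositiveLinearMap.mk₀
    { toFun := fun g => Λ g.toContinuousMap
      map_add' := fun a b => Λ.map_add _ _
      map_smul' := fun c a => Λ.map_smul _ _ } fun g hg => hΛ _ hg
  refine ⟨RealRMK.rieszMeasure Λ', inferInstance, fun g => ?_⟩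
  exact RealRMK.integral_rieszMeasure Λ' (CompactlySupportedContinuousMap.continuousMapEquiv g)

/-- The joint spectral measures of finitely many commuting self-adjoint operators. -/
theorem exists_joint_spectral_measure {H : Type*} [NormedAddCommGroup H] [InnerProductSpace ℂ H]
    [CompleteSpace H] {ι : Type*} [Countable ι] (R : ι → H →L[ℂ] H) (hsa : ∀ i, IsSelfAdjoint (R i))
    (hcomm : ∀ i j, R i * R j = R j * R i) :
    ∃ Φ : C(ι → ℝ, ℝ) →ₐ[ℝ] (H →L[ℂ] H), (∀ i, Φ ⟨fun y => y i, by fun_prop⟩ = R i) ∧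
      (∀ g, IsSelfAdjoint (Φ g)) ∧
      ∀ v, ∃ κ : Measure (ι → ℝ), IsFiniteMeasure κ ∧
        ∀ g : C(ι → ℝ, ℝ), Integrable g κ ∧ ∫ y, g y ∂κ = (inner ℂ v (Φ g v)).re := by
  obtain ⟨X, _, _, _, r, Ψ, hΨ⟩ := exists_joint_calculus R hsa hcomm
  let _ : MeasurableSpace X := borel X
  have : BorelSpace X := ⟨rfl⟩
  let ofReal : C(X, ℝ) →ₐ[ℝ] C(X, ℂ) :=
    Complex.ofRealAm.compLeftContinuous ℝ Complex.continuous_ofReal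
  let Ψr : C(X, ℝ) →ₐ[ℝ] (H →L[ℂ] H) := (Ψ.toAlgHom.restrictScalars ℝ).comp ofReal
  have hΨsa : ∀ g, IsSelfAdjoint (Ψr g) := by
    intro g
    have : IsSelfAdjoint (ofReal g) := by
      ext x; exact Complex.conj_ofReal _
    exact this.map Ψ
  let pull : C(ι → ℝ, ℝ) →ₐ[ℝ] C(X, ℝ) := ContinuousMap.compRightAlgHom ℝ ℝ r
  refine ⟨Ψr.comp pull, fun i => hΨ i, fun g => hΨsa _, fun v => ?_⟩
  let Λ : C(X, ℝ) →ₗ[ℝ] ℝ :=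
    { toFun := fun g => (inner ℂ v (Ψr g v)).re
      map_add' := fun a b => by
        rw [map_add, add_apply, inner_add_right, Complex.add_re]
      map_smul' := fun c a => by
        rw [map_smul, smul_apply, inner_smul_right_eq_smul]; simp }
  have hpos : ∀ g, 0 ≤ g → 0 ≤ Λ g := by
    intro g hg
    let s : C(X, ℝ) := ⟨fun x => √(g x), by fun_prop⟩
    have hs : g = s * s := by
      ext x; exact (Real.mul_self_sqrt (hg x)).symm
    have : Λ g = (inner ℂ (Ψr s v) (Ψr s v)).re := by
      change (inner ℂ v (Ψr g v)).re = _
      rw [hs, map_mul, mul_apply_eq_comp]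
      exact congrArg Complex.re
        ((ContinuousLinearMap.isSelfAdjoint_iff_isSymmetric.mp (hΨsa s)) v (Ψr s v)).symm
    rw [this]
    exact inner_self_nonneg (𝕜 := ℂ)
  obtain ⟨κ, hκ, h⟩ := exists_measure_of_positive Λ hpos
  refine ⟨κ.map r, inferInstance, fun g => ⟨?_, ?_⟩⟩
  · rw [integrable_map_measure g.continuous.aestronglyMeasurable r.continuous.aemeasurable]
    exact (g.comp r).continuous.integrable_of_hasCompactSupport
      (HasCompactSupport.of_compactSpace _)
  · rw [integral_map r.continuous.aemeasurable g.continuous.aestronglyMeasurable]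
    exact h (g.comp r)

section SpectralMeasure

variable {H : Type*} [NormedAddCommGroup H] [InnerProductSpace ℂ H] [CompleteSpace H]
  {ι : Type*} {Φ : C(ι → ℝ, ℝ) →ₐ[ℝ] (H →L[ℂ] H)}

theorem inner_calculus_mul (hΦ : ∀ g, IsSelfAdjoint (Φ g)) (g h : C(ι → ℝ, ℝ)) (v : H) :
    inner ℂ v (Φ (g * h) v) = inner ℂ (Φ g v) (Φ h v) := by
  rw [map_mul, mul_apply_eq_comp]
  exact ((ContinuousLinearMap.isSelfAdjoint_iff_isSymmetric.mp (hΦ g)) v (Φ h v)).symm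

theorem ae_nonneg_of_calculus_nonneg (hΦ : ∀ g, IsSelfAdjoint (Φ g)) {κ : Measure (ι → ℝ)} {v : H}
    (hκ : ∀ g : C(ι → ℝ, ℝ), Integrable g κ ∧ ∫ y, g y ∂κ = (inner ℂ v (Φ g v)).re)
    (ψ : C(ι → ℝ, ℝ)) (hψ : ∀ u, 0 ≤ (inner ℂ u (Φ ψ u)).re) : ∀ᵐ y ∂κ, 0 ≤ ψ y := by
  let g : C(ι → ℝ, ℝ) := ⟨fun y => max (-ψ y) 0, by fun_prop⟩
  have h1 : 0 ≤ ∫ y, (g * (ψ * g)) y ∂κ := by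
    rw [(hκ _).2, inner_calculus_mul hΦ, map_mul, mul_apply_eq_comp]
    exact hψ _
  have hg : ∀ y, (g * (ψ * g)) y = -(max (-ψ y) 0) ^ 3 := by
    intro y
    change max (-ψ y) 0 * (ψ y * max (-ψ y) 0) = _
    rcases le_total (-ψ y) 0 with h | h
    · rw [max_eq_right h]; simp
    · rw [max_eq_left h]; ring
  have h2 : Integrable (fun y => (max (-ψ y) 0) ^ 3) κ := by
    refine (hκ (g * (ψ * g))).1.neg.congr (Filter.Eventually.of_forall fun y => ?_)
    rw [Pi.neg_apply, hg, neg_neg]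
  have h3 : ∫ y, (max (-ψ y) 0) ^ 3 ∂κ = 0 := by
    simp only [hg] at h1
    rw [integral_neg] at h1
    exact le_antisymm (by linarith) (integral_nonneg fun y => by positivity)
  rw [integral_eq_zero_iff_of_nonneg (fun y => by positivity) h2] at h3
  filter_upwards [h3] with y hy
  have : max (-ψ y) 0 = 0 := eq_zero_of_pow_eq_zero (n := 3) hy
  have := le_max_left (-ψ y) 0
  linarith

theorem spectral_measure_eq_withDensity [Countable ι] (hΦ : ∀ g, IsSelfAdjoint (Φ g))
    {κ κ' : Measure (ι → ℝ)} [IsFiniteMeasure κ] [IsFiniteMeasure κ'] {v : H} (s : C(ι → ℝ, ℝ))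
    (hκ : ∀ g : C(ι → ℝ, ℝ), Integrable g κ ∧ ∫ y, g y ∂κ = (inner ℂ (Φ s v) (Φ g (Φ s v))).re)
    (hκ' : ∀ g : C(ι → ℝ, ℝ), Integrable g κ' ∧ ∫ y, g y ∂κ' = (inner ℂ v (Φ g v)).re) :
    κ = κ'.withDensity fun y => ENNReal.ofReal (s y ^ 2) := by
  have hs : Measurable fun y => (s y ^ 2).toNNReal := by
    have := s.continuous.measurable
    fun_prop
  have : IsFiniteMeasure (κ'.withDensity fun y => ENNReal.ofReal (s y ^ 2)) := by
    refine isFiniteMeasure_withDensity_ofReal ?_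
    have := (hκ' (s ^ 2)).1.2
    exact this
  refine ext_of_forall_integral_eq_of_IsFiniteMeasure fun g => ?_
  have e := integral_withDensity_eq_integral_smul (μ := κ') hs (fun y => g y)
  refine Eq.trans ?_ e.symm
  have h1 := (hκ g.toContinuousMap).2
  have h2 := (hκ' (s * (g.toContinuousMap * s))).2
  rw [inner_calculus_mul hΦ, map_mul, mul_apply_eq_comp, ← h1] at h2
  refine h2.symm.trans (integral_congr_ae (Filter.Eventually.of_forall fun y => ?_))
  change s y * (g y * s y) = (s y ^ 2).toNNReal • g y
  rw [NNReal.smul_def, Real.coe_toNNReal _ (sq_nonneg _), smul_eq_mul]; ring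

end SpectralMeasure

theorem exists_measure_of_resolvents {H : Type*} [NormedAddCommGroup H] [InnerProductSpace ℂ H]
    [CompleteSpace H] {m : ℕ} (R : Fin m → H →L[ℂ] H) (hsa : ∀ i, IsSelfAdjoint (R i))
    (hcomm : ∀ i j, R i * R j = R j * R i)
    (hpos : ∀ i u, 0 ≤ (inner ℂ u (R i u - R i (R i u))).re)
    {A : Type*} [CommRing A] [Algebra ℝ A] (L : A →ₗ[ℝ] ℝ) (J : A →ₗ[ℝ] H)
    (hJ : ∀ a b, inner ℂ (J a) (J b) = (L (a * b) : ℂ)) (f : Fin m → A)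
    (hR : ∀ i a, R i (J ((1 + f i) * a)) = J a) :
    ∃ ν : Measure (Fin m → ℝ), (∀ᵐ y ∂ν, ∀ i, 0 ≤ y i) ∧ ∀ h : MvPolynomial (Fin m) ℝ,
      Integrable (fun y => eval y h) ν ∧ ∫ y, eval y h ∂ν = L (aeval f h) := by
  obtain ⟨Φ, hΦR, hΦ, hκ⟩ := exists_joint_spectral_measure R hsa hcomm
  let r : Fin m → C(Fin m → ℝ, ℝ) := fun i => ⟨fun y => y i, by fun_prop⟩
  let P : C(Fin m → ℝ, ℝ) → A → A → Prop := fun g b c => ∀ a, Φ g (J (b * a)) = J (c * a)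
  have hPmul : ∀ {g g' b b' c c'}, P g b c → P g' b' c' → P (g * g') (b * b') (c * c') := by
    intro g g' b b' c c' h h' a
    rw [map_mul, mul_apply_eq_comp, mul_comm b, mul_assoc, h', mul_left_comm, h, mul_assoc]
  have hPone : P 1 1 1 := fun a => by simp
  have hPpow : ∀ {g b c} (n : ℕ), P g b c → P (g ^ n) (b ^ n) (c ^ n) := by
    intro g b c n h
    induction n with
    | zero => simpa using hPone
    | succ n ih => simpa only [pow_succ] using hPmul ih h
  have hPprod : ∀ (g : Fin m → C(Fin m → ℝ, ℝ)) (b c : Fin m → A), (∀ i, P (g i) (b i) (c i)) →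
      P (∏ i, g i) (∏ i, b i) (∏ i, c i) := by
    intro g b c h
    induction (Finset.univ : Finset (Fin m)) using Finset.induction_on with
    | empty => simpa using hPone
    | insert i s hi ih => simpa only [Finset.prod_insert hi] using hPmul (h i) ih
  have hP1 : ∀ i, P (r i) (1 + f i) 1 := fun i a => by rw [hΦR, hR, one_mul]
  have hP2 : ∀ i, P (1 - r i) (1 + f i) (f i) := fun i a => by
    rw [map_sub, map_one, sub_apply, hP1, one_apply_eq_self, ← map_sub]
    congr 1; ring
  obtain ⟨κ, hκfin, hκ1⟩ := hκ (J 1)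
  let g₁ : (Fin m → ℕ) → C(Fin m → ℝ, ℝ) := fun α => ∏ i, r i ^ α i
  let g₂ : (Fin m → ℕ) → C(Fin m → ℝ, ℝ) := fun α => ∏ i, (1 - r i) ^ α i
  have key : ∀ α : Fin m → ℕ, ∃ κ' : Measure (Fin m → ℝ),
      κ = κ'.withDensity (fun y => ENNReal.ofReal (g₁ α y ^ 2)) ∧
      Integrable (g₁ α * g₂ α) κ' ∧ ∫ y, (g₁ α * g₂ α) y ∂κ' = L (∏ i, f i ^ α i) := by
    intro α
    have h1 : Φ (g₁ α) (J (∏ i, (1 + f i) ^ α i)) = J 1 := by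
      simpa using hPprod _ _ _ (fun i => hPpow (α i) (hP1 i)) 1
    have h2 : Φ (g₂ α) (J (∏ i, (1 + f i) ^ α i)) = J (∏ i, f i ^ α i) := by
      simpa using hPprod _ _ _ (fun i => hPpow (α i) (hP2 i)) 1
    obtain ⟨κ', hκ'fin, hκ'⟩ := hκ (J (∏ i, (1 + f i) ^ α i))
    refine ⟨κ', ?_, (hκ' (g₁ α * g₂ α)).1, ?_⟩
    · refine spectral_measure_eq_withDensity hΦ (g₁ α) ?_ hκ'
      rw [h1]; exact hκ1
    · rw [(hκ' _).2, inner_calculus_mul hΦ, h1, h2, hJ, one_mul, Complex.ofReal_re]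
  have hmom : ∀ α : Fin m → ℕ, Integrable (fun y => ∏ i, ((y i)⁻¹ - 1) ^ α i) κ ∧
      ∫ y, ∏ i, ((y i)⁻¹ - 1) ^ α i ∂κ = L (∏ i, f i ^ α i) := by
    intro α
    obtain ⟨κ', h1, h2, h3⟩ := key α
    have hs : Measurable fun y => (g₁ α y ^ 2).toNNReal := by
      have := (g₁ α).continuous.measurable
      fun_prop
    have e : ∀ y : Fin m → ℝ, (g₁ α y ^ 2).toNNReal • ∏ i, ((y i)⁻¹ - 1) ^ α i =
        (g₁ α * g₂ α) y := by
      intro y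
      rw [NNReal.smul_def, Real.coe_toNNReal _ (sq_nonneg _), smul_eq_mul, ContinuousMap.mul_apply]
      simp only [g₁, g₂, r, ContinuousMap.prod_apply, ContinuousMap.pow_apply,
        ContinuousMap.sub_apply, ContinuousMap.one_apply, ContinuousMap.coe_mk]
      rw [← Finset.prod_pow, ← Finset.prod_mul_distrib, ← Finset.prod_mul_distrib]
      refine Finset.prod_congr rfl fun i _ => ?_
      rw [pow_two, mul_assoc, ← mul_pow, ← mul_pow, ← mul_pow]
      rcases eq_or_ne (y i) 0 with h | h
      · simp [h]
      · congr 1; field_simp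
    have h1' : κ = κ'.withDensity (fun y => ((g₁ α y ^ 2).toNNReal : ENNReal)) := h1
    rw [h1']
    constructor
    · rw [integrable_withDensity_iff_integrable_smul hs]
      exact h2.congr (Filter.Eventually.of_forall fun y => (e y).symm)
    · rw [integral_withDensity_eq_integral_smul hs, ← h3]
      exact integral_congr_ae (Filter.Eventually.of_forall e)
  have hsupp : ∀ᵐ y ∂κ, ∀ i, 0 ≤ (y i)⁻¹ - 1 := by
    rw [ae_all_iff]
    intro i
    have h1 := ae_nonneg_of_calculus_nonneg hΦ hκ1 (r i - r i * r i) fun u => by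
      rw [map_sub, map_mul, hΦR]; exact hpos i u
    have h2 : ∀ᵐ y ∂κ, y i ≠ 0 := by
      obtain ⟨κ', h3, -⟩ := key (Pi.single i 1)
      rw [h3, ae_withDensity_iff (by
        have := (g₁ (Pi.single i 1)).continuous.measurable
        fun_prop)]
      refine Filter.Eventually.of_forall fun y hy h0 => hy ?_
      have : g₁ (Pi.single i 1) y = 0 := by
        simp only [g₁, r, ContinuousMap.prod_apply, ContinuousMap.pow_apply, ContinuousMap.coe_mk]
        exact Finset.prod_eq_zero (Finset.mem_univ i) (by simp [h0])
      rw [this]; simp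
    filter_upwards [h1, h2] with y hy hy0
    have hy : 0 ≤ y i - y i * y i := hy
    have h4 : 0 < y i := lt_of_le_of_ne (by nlinarith [mul_self_nonneg (y i)]) hy0.symm
    have h5 : y i ≤ 1 := by nlinarith
    linarith [(one_le_inv₀ h4).mpr h5]
  have hmeas : Measurable fun (y : Fin m → ℝ) (i : Fin m) => (y i)⁻¹ - 1 := by fun_prop
  refine ⟨κ.map fun y i => (y i)⁻¹ - 1, ?_, fun h => ?_⟩
  · rw [ae_map_iff hmeas.aemeasurable (by
      simp only [Set.ofPred_forall]
      exact MeasurableSet.iInter fun i =>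
        measurableSet_le measurable_const (measurable_pi_apply i))]
    exact hsupp
  · have hc : Continuous fun y : Fin m → ℝ => eval y h := h.continuous_eval
    rw [integrable_map_measure hc.aestronglyMeasurable hmeas.aemeasurable,
      integral_map hmeas.aemeasurable hc.aestronglyMeasurable]
    clear hc
    change Integrable (fun y : Fin m → ℝ => eval (fun i => (y i)⁻¹ - 1) h) κ ∧ _
    induction h using MvPolynomial.induction_on' with
    | monomial u a =>
      simp only [eval_monomial, aeval_monomial, Finsupp.prod_fintype _ _ (fun i => pow_zero _)]
      refine ⟨(hmom u).1.const_mul a, ?_⟩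
      rw [integral_const_mul, (hmom u).2, ← Algebra.smul_def, map_smul, smul_eq_mul]
    | add p q hp hq =>
      simp only [map_add]
      exact ⟨hp.1.add hq.1, by rw [integral_add hp.1 hq.1, hp.2, hq.2]⟩

/-- Separation and completion of a complex vector space with a semidefinite inner product. -/
theorem exists_hilbert_completion.{u} {V : Type u} [AddCommGroup V] [Module ℂ V]
    (c : PreInnerProductSpace.Core ℂ V) :
    ∃ (H : Type u) (_ : NormedAddCommGroup H) (_ : InnerProductSpace ℂ H) (_ : CompleteSpace H)
      (ι : V →ₗ[ℂ] H), DenseRange ι ∧ ∀ x y, inner ℂ (ι x) (ι y) = c.inner x y := by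
  let _ : SeminormedAddCommGroup V := @InnerProductSpace.Core.toSeminormedAddCommGroup ℂ V _ _ _ c
  let _ : InnerProductSpace ℂ V := InnerProductSpace.ofCore c
  refine ⟨UniformSpace.Completion V, inferInstance, inferInstance, inferInstance,
    (UniformSpace.Completion.toComplL (𝕜 := ℂ) (E := V)).toLinearMap,
    UniformSpace.Completion.denseRange_coe, fun x y => ?_⟩
  exact UniformSpace.Completion.inner_coe x y

theorem exists_resolvent {H E : Type*} [NormedAddCommGroup H] [InnerProductSpace ℂ H]
    [CompleteSpace H] [AddCommGroup E] [Module ℂ E] (ι e : E →ₗ[ℂ] H) (he : DenseRange e)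
    (hsymm : ∀ u v, inner ℂ (e u) (ι v) = inner ℂ (ι u) (e v))
    (hle : ∀ u, ‖ι u‖ ^ 2 ≤ (inner ℂ (e u) (ι u)).re) :
    ∃ R : H →L[ℂ] H, (∀ u, R (e u) = ι u) ∧ IsSelfAdjoint R ∧
      ∀ u, 0 ≤ (inner ℂ u (R u - R (R u))).re := by
  have hnorm : ∀ u, ‖ι u‖ ≤ 1 * ‖e u‖ := by
    intro u
    rw [one_mul]
    by_contra! h
    have h1 : (inner ℂ (e u) (ι u)).re ≤ ‖e u‖ * ‖ι u‖ :=
      (Complex.re_le_norm _).trans (norm_inner_le_norm _ _)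
    nlinarith [hle u, norm_nonneg (e u)]
  have hR : ∀ u, ι.extendOfNorm e (e u) = ι u := LinearMap.extendOfNorm_eq he ⟨1, hnorm⟩
  set R := ι.extendOfNorm e
  have hRs : ∀ x y, inner ℂ (R x) y = inner ℂ x (R y) := by
    intro x y
    refine he.induction_on₂ (p := fun x y => inner ℂ (R x) y = inner ℂ x (R y))
      (isClosed_eq (by fun_prop) (by fun_prop)) (fun u v => ?_) x y
    rw [hR, hR, hsymm]
  refine ⟨R, hR, ?_, fun x => ?_⟩
  · exact ContinuousLinearMap.isSelfAdjoint_iff_isSymmetric.mpr hRs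
  · refine he.induction_on (p := fun x => 0 ≤ (inner ℂ x (R x - R (R x))).re) x
      (isClosed_le (by fun_prop) (by fun_prop)) fun u => ?_
    rw [inner_sub_right, ← hRs (e u) (R (e u)), hR, Complex.sub_re, inner_self_eq_norm_sq_to_K]
    norm_cast
    exact sub_nonneg.mpr (hle u)

section Complexification

variable {σ : Type*}

theorem MvPolynomial.exists_eq_map_add_I_mul_map (p : MvPolynomial σ ℂ) :
    ∃ a b : MvPolynomial σ ℝ,
      p = map Complex.ofRealHom a + C Complex.I * map Complex.ofRealHom b := by
  induction p using MvPolynomial.induction_on' with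
  | monomial u z =>
    refine ⟨monomial u z.re, monomial u z.im, ?_⟩
    rw [map_monomial, map_monomial, C_mul_monomial, ← map_add, mul_comm Complex.I]
    exact congrArg _ (Complex.re_add_im z).symm
  | add p q hp hq =>
    obtain ⟨a, b, rfl⟩ := hp
    obtain ⟨c, d, rfl⟩ := hq
    exact ⟨a + c, b + d, by simp only [map_add]; ring⟩

/-- The coefficientwise complex conjugate of a polynomial. -/
noncomputable def MvPolynomial.conjCoeff : MvPolynomial σ ℂ →+* MvPolynomial σ ℂ :=
  map (starRingEnd ℂ)

theorem MvPolynomial.conjCoeff_map_ofReal (a : MvPolynomial σ ℝ) :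
    conjCoeff (map Complex.ofRealHom a) = map Complex.ofRealHom a := by
  rw [conjCoeff, map_map]
  have : (starRingEnd ℂ).comp Complex.ofRealHom = Complex.ofRealHom :=
    RingHom.ext Complex.conj_ofReal
  rw [this]

theorem MvPolynomial.conjCoeff_C (z : ℂ) :
    conjCoeff (C z : MvPolynomial σ ℂ) = C (starRingEnd ℂ z) := map_C _ _

/-- The complex-linear extension of a real-linear functional on real polynomials. -/
noncomputable def MvPolynomial.complexify (L : MvPolynomial σ ℝ →ₗ[ℝ] ℝ) :
    MvPolynomial σ ℂ →ₗ[ℂ] ℂ :=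
  (basisMonomials σ ℂ).constr ℂ fun s => (L (monomial s 1) : ℂ)

theorem MvPolynomial.complexify_map_ofReal (L : MvPolynomial σ ℝ →ₗ[ℝ] ℝ)
    (a : MvPolynomial σ ℝ) : complexify L (map Complex.ofRealHom a) = L a := by
  induction a using MvPolynomial.induction_on' with
  | monomial u x =>
    have h1 : (monomial u) ((x : ℝ) : ℂ) = (x : ℂ) • basisMonomials σ ℂ u := by
      simp [smul_monomial]
    have h2 : monomial u x = x • (monomial u 1 : MvPolynomial σ ℝ) := by simp [smul_monomial]
    rw [map_monomial, Complex.ofRealHom_eq_coe, h1, h2, map_smul, map_smul, complexify,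
      Module.Basis.constr_basis]
    simp
  | add p q hp hq => simp only [map_add, hp, hq, Complex.ofReal_add]

theorem MvPolynomial.complexify_add_I_mul (L : MvPolynomial σ ℝ →ₗ[ℝ] ℝ)
    (a b : MvPolynomial σ ℝ) :
    complexify L (map Complex.ofRealHom a + C Complex.I * map Complex.ofRealHom b) =
      L a + Complex.I * L b := by
  rw [map_add, ← smul_eq_C_mul, map_smul, complexify_map_ofReal, complexify_map_ofReal,
    smul_eq_mul]

theorem MvPolynomial.complexify_conjCoeff (L : MvPolynomial σ ℝ →ₗ[ℝ] ℝ) (p : MvPolynomial σ ℂ) :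
    complexify L (conjCoeff p) = starRingEnd ℂ (complexify L p) := by
  obtain ⟨a, b, rfl⟩ := exists_eq_map_add_I_mul_map p
  have : conjCoeff (map Complex.ofRealHom a + C Complex.I * map Complex.ofRealHom b) =
      map Complex.ofRealHom a + C Complex.I * map Complex.ofRealHom (-b) := by
    rw [map_add, map_mul, conjCoeff_map_ofReal, conjCoeff_map_ofReal, conjCoeff_C,
      Complex.conj_I, map_neg, map_neg]
    ring
  rw [this, complexify_add_I_mul, complexify_add_I_mul]
  simp

theorem MvPolynomial.complexify_conjCoeff_mul_map_mul_nonneg (L : MvPolynomial σ ℝ →ₗ[ℝ] ℝ)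
    {g : MvPolynomial σ ℝ} (hg : ∀ a, 0 ≤ L (g * (a * a))) (p : MvPolynomial σ ℂ) :
    0 ≤ (complexify L (conjCoeff p * (map Complex.ofRealHom g * p))).re := by
  obtain ⟨a, b, rfl⟩ := exists_eq_map_add_I_mul_map p
  have hI : (C Complex.I * C Complex.I : MvPolynomial σ ℂ) = -1 := by
    rw [← C_mul, Complex.I_mul_I, C_neg, C_1]
  have : conjCoeff (map Complex.ofRealHom a + C Complex.I * map Complex.ofRealHom b) *
      (map Complex.ofRealHom g *
        (map Complex.ofRealHom a + C Complex.I * map Complex.ofRealHom b)) =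
      map Complex.ofRealHom (g * (a * a) + g * (b * b)) := by
    rw [map_add, map_mul, conjCoeff_map_ofReal, conjCoeff_map_ofReal, conjCoeff_C,
      Complex.conj_I, C_neg]
    simp only [map_add, map_mul]
    linear_combination (-(map Complex.ofRealHom g) * (map Complex.ofRealHom b) ^ 2) * hI
  rw [this, complexify_map_ofReal, Complex.ofReal_re, map_add]
  exact add_nonneg (hg a) (hg b)

/-- The Gelfand-Naimark-Segal construction for a positive functional on real polynomials. -/
theorem MvPolynomial.exists_gelfand_naimark_segal.{u} {σ : Type u}
    (L : MvPolynomial σ ℝ →ₗ[ℝ] ℝ)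
    (hL : ∀ a, 0 ≤ L (a * a)) :
    ∃ (H : Type u) (_ : NormedAddCommGroup H) (_ : InnerProductSpace ℂ H) (_ : CompleteSpace H)
      (ι : MvPolynomial σ ℂ →ₗ[ℂ] H), DenseRange ι ∧
      ∀ p q, inner ℂ (ι p) (ι q) = complexify L (conjCoeff p * q) := by
  refine exists_hilbert_completion
    { inner := fun p q => complexify L (conjCoeff p * q)
      conj_inner_symm := fun p q => ?_
      re_inner_nonneg := fun p => ?_
      add_left := fun p q r => ?_
      smul_left := fun p q z => ?_ }
  · rw [← complexify_conjCoeff, map_mul, mul_comm]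
    congr 2
    have : (starRingEnd ℂ).comp (starRingEnd ℂ) = RingHom.id ℂ :=
      RingHom.ext Complex.conj_conj
    rw [conjCoeff, map_map, this, map_id]
  · simpa using complexify_conjCoeff_mul_map_mul_nonneg L (g := 1) (by simpa using hL) p
  · rw [map_add, add_mul, map_add]
  · rw [smul_eq_C_mul, map_mul conjCoeff, conjCoeff_C, mul_assoc, ← smul_eq_C_mul, map_smul,
      smul_eq_mul]

end Complexification

theorem exists_measure_of_stieltjes {σ : Type*} {m : ℕ} (f : Fin m → MvPolynomial σ ℝ)
    (L : MvPolynomial σ ℝ →ₗ[ℝ] ℝ) (hL : ∀ a, 0 ≤ L (a * a))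
    (hf : ∀ j a, 0 ≤ L (f j * (a * a)))
    (hC : ∀ j, ∑' n : ℕ,
      (ENNReal.ofReal (L (f j ^ (n + 1)))) ^ (-(1 / (2 * ((n : ℝ) + 1)))) = ⊤) :
    ∃ ν : Measure (Fin m → ℝ), (∀ᵐ y ∂ν, ∀ i, 0 ≤ y i) ∧ ∀ h : MvPolynomial (Fin m) ℝ,
      Integrable (fun y => eval y h) ν ∧ ∫ y, eval y h ∂ν = L (aeval f h) := by
  obtain ⟨H, _, _, _, ι, hdense, hι⟩ := exists_gelfand_naimark_segal L hL
  let e : MvPolynomial σ ℝ → MvPolynomial σ ℂ →ₗ[ℂ] H := fun g =>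
    ι ∘ₗ LinearMap.mulLeft ℂ (map Complex.ofRealHom g)
  have he : ∀ g p, e g p = ι (map Complex.ofRealHom g * p) := fun g p => rfl
  have hJ : ∀ a b : MvPolynomial σ ℝ, inner ℂ (ι (map Complex.ofRealHom a))
      (ι (map Complex.ofRealHom b)) = (L (a * b) : ℂ) := fun a b => by
    rw [hι, conjCoeff_map_ofReal, ← map_mul, complexify_map_ofReal]
  have hnorm : ∀ a : MvPolynomial σ ℝ, ‖ι (map Complex.ofRealHom a)‖ ^ 2 = L (a * a) := by
    intro a
    rw [← inner_self_eq_norm_sq (𝕜 := ℂ), hJ]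
    exact Complex.ofReal_re _
  have hsymm : ∀ g p q, inner ℂ (e g p) (ι q) = inner ℂ (ι p) (e g q) := by
    intro g p q
    rw [he, he, hι, hι, map_mul conjCoeff, conjCoeff_map_ofReal]
    congr 1; ring
  have hstep : ∀ g j, DenseRange (e g) → DenseRange (e (g * (1 + f j))) := by
    intro g j hg
    refine Dense.of_closure (hg.mono ?_)
    rintro _ ⟨p, rfl⟩
    rw [Metric.mem_closure_range_iff]
    intro ε hε
    obtain ⟨a, b, rfl⟩ := exists_eq_map_add_I_mul_map p
    obtain ⟨Q₁, h₁⟩ := exists_one_add_mul_approx L hL (f j) (hf j) (hC j) (g * a)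
      (ε := (ε / 2) ^ 2) (by positivity)
    obtain ⟨Q₂, h₂⟩ := exists_one_add_mul_approx L hL (f j) (hf j) (hC j) (g * b)
      (ε := (ε / 2) ^ 2) (by positivity)
    rw [← hnorm] at h₁ h₂
    have h₁ := lt_of_pow_lt_pow_left₀ 2 (by positivity) h₁
    have h₂ := lt_of_pow_lt_pow_left₀ 2 (by positivity) h₂
    refine ⟨map Complex.ofRealHom (Polynomial.aeval (f j) Q₁ * a) +
      C Complex.I * map Complex.ofRealHom (Polynomial.aeval (f j) Q₂ * b), ?_⟩
    rw [dist_eq_norm, he, he, ← map_sub]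
    have : map Complex.ofRealHom g *
        (map Complex.ofRealHom a + C Complex.I * map Complex.ofRealHom b) -
        map Complex.ofRealHom (g * (1 + f j)) *
          (map Complex.ofRealHom (Polynomial.aeval (f j) Q₁ * a) +
            C Complex.I * map Complex.ofRealHom (Polynomial.aeval (f j) Q₂ * b)) =
        map Complex.ofRealHom (g * a - (1 + f j) * Polynomial.aeval (f j) Q₁ * (g * a)) +
        C Complex.I * map Complex.ofRealHom
          (g * b - (1 + f j) * Polynomial.aeval (f j) Q₂ * (g * b)) := by
      simp only [map_sub, map_mul]; ring
    rw [this, map_add, ← smul_eq_C_mul, map_smul]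
    refine (norm_add_le _ _).trans_lt ?_
    rw [norm_smul, Complex.norm_I, one_mul]
    linarith
  have hdense1 : ∀ j, DenseRange (e (1 + f j)) := by
    intro j
    have h1 : e 1 = ι := LinearMap.ext fun p => by rw [he, map_one, one_mul]
    simpa using hstep 1 j (by rwa [h1])
  have hres : ∀ j, ∃ R : H →L[ℂ] H, (∀ u, R (e (1 + f j) u) = ι u) ∧ IsSelfAdjoint R ∧
      ∀ u, 0 ≤ (inner ℂ u (R u - R (R u))).re := by
    intro j
    refine exists_resolvent ι (e (1 + f j)) (hdense1 j) (hsymm _) fun p => ?_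
    have h1 : ((‖ι p‖ ^ 2 : ℝ) : ℂ) = inner ℂ (ι p) (ι p) := by
      rw [inner_self_eq_norm_sq_to_K]; norm_cast
    have h2 := complexify_conjCoeff_mul_map_mul_nonneg L (hf j) p
    rw [← hι] at h2
    rw [hsymm, he, map_add, map_one, add_mul, one_mul, map_add, inner_add_right, ← h1,
      Complex.add_re, Complex.ofReal_re]
    linarith
  choose R hR hRsa hRpos using hres
  have hcomp : ∀ i j p, R i (R j (e ((1 + f i) * (1 + f j)) p)) = ι p := by
    intro i j p
    rw [he, mul_comm (1 + f i), map_mul (map Complex.ofRealHom), mul_assoc, ← he, hR, ← he, hR]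
  refine exists_measure_of_resolvents R hRsa (fun i j => ?_) hRpos L
    ((ι.restrictScalars ℝ).comp (MvPolynomial.mapAlgHom Complex.ofRealAm).toLinearMap) hJ f ?_
  · refine ContinuousLinearMap.coeFn_injective ?_
    refine (hstep _ j (hdense1 i)).equalizer (R i * R j).continuous (R j * R i).continuous ?_
    funext p
    refine (hcomp i j p).trans ?_
    rw [mul_comm (1 + f i)]
    exact (hcomp j i p).symm
  · intro i a
    have := hR i (map Complex.ofRealHom a)
    rw [he, ← map_mul] at this
    exact this

/-- Theorem 2 (K-moment problem for semi-algebraic sets): if `f₁,…,f_m` generate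
`ℝ[x₁,…,x_d]` as an ℝ-algebra and a linear functional `L` satisfies `L(p²) ≥ 0`,
`L(f_j p²) ≥ 0` and `∑ₙ L(f_jⁿ)^{-1/(2n)} = +∞` for each `j`, then `L` is a moment
functional with a unique representing measure, supported on
`K(f) = {x : f₁(x) ≥ 0, …, f_m(x) ≥ 0}`. -/
theorem semialgebraic_moment_problem
    (d m : ℕ) (f : Fin m → MvPolynomial (Fin d) ℝ)
    (hgen : Algebra.adjoin ℝ (Set.range f) = (⊤ : Subalgebra ℝ (MvPolynomial (Fin d) ℝ)))
    (L : MvPolynomial (Fin d) ℝ →ₗ[ℝ] ℝ)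
    (hsq : ∀ p : MvPolynomial (Fin d) ℝ, 0 ≤ L (p ^ 2))
    (hfsq : ∀ (j : Fin m) (p : MvPolynomial (Fin d) ℝ), 0 ≤ L (f j * p ^ 2))
    (hstieltjes : ∀ j : Fin m,
      ∑' n : ℕ,
        (ENNReal.ofReal (L (f j ^ (n + 1)))) ^ (-(1 / (2 * ((n : ℝ) + 1)))) = ⊤) :
    (∃ μ : Measure (Fin d → ℝ),
      μ {x | ¬ ∀ j : Fin m, 0 ≤ eval x (f j)} = 0 ∧
      (∀ p : MvPolynomial (Fin d) ℝ, Integrable (fun x => eval x p) μ) ∧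
      (∀ p : MvPolynomial (Fin d) ℝ, L p = ∫ x, eval x p ∂μ)) ∧
    (∀ μ₁ μ₂ : Measure (Fin d → ℝ),
      (∀ p : MvPolynomial (Fin d) ℝ, Integrable (fun x => eval x p) μ₁) →
      (∀ p : MvPolynomial (Fin d) ℝ, L p = ∫ x, eval x p ∂μ₁) →
      (∀ p : MvPolynomial (Fin d) ℝ, Integrable (fun x => eval x p) μ₂) →
      (∀ p : MvPolynomial (Fin d) ℝ, L p = ∫ x, eval x p ∂μ₂) →
      μ₁ = μ₂) := by
  have hL : ∀ a, 0 ≤ L (a * a) := fun a => by simpa only [pow_two] using hsq a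
  have hfL : ∀ j a, 0 ≤ L (f j * (a * a)) := fun j a => by simpa only [pow_two] using hfsq j a
  refine ⟨?_, fun μ₁ μ₂ hi₁ h₁ hi₂ h₂ => ?_⟩
  · obtain ⟨ν, hν, hmom⟩ := exists_measure_of_stieltjes f L hL hfL hstieltjes
    have hX : ∀ i, ∃ g : MvPolynomial (Fin m) ℝ, aeval f g = X i := fun i => by
      have : (X i : MvPolynomial (Fin d) ℝ) ∈ Algebra.adjoin ℝ (Set.range f) := by
        rw [hgen]; trivial
      rwa [Algebra.adjoin_range_eq_range_aeval] at this
    choose g hg using hX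
    have hG : Continuous fun (y : Fin m → ℝ) i => eval y (g i) :=
      continuous_pi fun i => (g i).continuous_eval
    have heval : ∀ (p : MvPolynomial (Fin d) ℝ) (y : Fin m → ℝ),
        eval (fun i => eval y (g i)) p = eval y (aeval g p) := fun p y => by
      have := comp_aeval_apply (f := g) (aeval y) p
      simp only [aeval_eq_eval] at this
      exact this.symm
    have hinv : ∀ p : MvPolynomial (Fin d) ℝ, aeval f (aeval g p) = p := fun p => by
      rw [comp_aeval_apply, funext hg, aeval_X_left_apply]
    have hker : ∀ h : MvPolynomial (Fin m) ℝ, aeval f h = 0 → ∀ᵐ y ∂ν, eval y h = 0 := by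
      intro h hh
      obtain ⟨h1, h2⟩ := hmom (h * h)
      rw [map_mul, hh, zero_mul, map_zero, integral_eq_zero_iff_of_nonneg _ h1] at h2
      · filter_upwards [h2] with y hy
        exact mul_self_eq_zero.mp ((map_mul (eval y) h h).symm.trans hy)
      · intro y
        change 0 ≤ eval y (h * h)
        rw [map_mul]
        exact mul_self_nonneg _
    refine ⟨ν.map fun y i => eval y (g i), ?_, fun p => ?_, fun p => ?_⟩
    · have hsupp : ∀ᵐ y ∂ν, ∀ j, 0 ≤ eval (fun i => eval y (g i)) (f j) := by
        have h1 : ∀ᵐ y ∂ν, ∀ j, eval y (aeval g (f j) - X j) = 0 :=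
          ae_all_iff.mpr fun j => hker _ (by rw [map_sub, hinv, aeval_X, sub_self])
        filter_upwards [hν, h1] with y hy h1 j
        rw [heval, ← sub_add_cancel (aeval g (f j)) (X j), map_add, h1, eval_X, zero_add]
        exact hy j
      refine (ae_map_iff hG.measurable.aemeasurable ?_).mpr hsupp
      rw [Set.ofPred_forall]
      exact MeasurableSet.iInter fun j =>
        measurableSet_le measurable_const (f j).continuous_eval.measurable
    · exact (integrable_map_measure p.continuous_eval.aestronglyMeasurable
        hG.measurable.aemeasurable).mpr ((hmom (aeval g p)).1.congr
          (Filter.Eventually.of_forall fun y => (heval p y).symm))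
    · rw [integral_map hG.measurable.aemeasurable p.continuous_eval.aestronglyMeasurable]
      simp only [heval]
      rw [(hmom _).2, hinv]
  · refine measure_eq_of_moments_eq hgen hi₁ hi₂ (fun p => (h₁ p).symm.trans (h₂ p)) ?_
    intro j p ε hε
    obtain ⟨Q, hQ⟩ := exists_one_add_sq_mul_approx L hL (f j) (hfL j) (hstieltjes j) p hε
    refine ⟨Polynomial.aeval (f j) Q * p, ?_⟩
    rwa [← h₁, ← mul_assoc]
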